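/- arXiv:2108.01564 — 8 statements merged into one kernel-verified Lean document; each statement's English description precedes it below -/
import Mathlib

section
/- Let m and n be natural numbers, and define the 4×4 integer matrices (rows and columns indexed by the simple objects 1, ρ, αρ, α of the fusion ring R with α² = 1 and ρ² = 1 ⊕ mρ ⊕ nαρ): L_ρ = [[0,1,0,0],[1,m,n,0],[0,n,m,1],[0,0,1,0]], L_{αρ} = [[0,0,1,0],[0,n,m,1],[1,m,n,0],[0,1,0,0]], L_α = [[0,0,0,1],[0,0,1,0],[0,1,0,0],[1,0,0,0]], and set R := I + L_ρ² + L_{αρ}² + L_α². Then R equals the matrix [[4, 2m, 2n, 0],[2m, 2n²+2m²+4, 4mn, 2n],[2n, 4mn, 2n²+2m²+4, 2m],[0, 2n, 2m, 4]], and the characteristic polynomial of R, viewed as a real matrix, factors as (X − f₁)(X − f₂)(X − f₃)(X − f₄), where f₁ = 4+(m+n)²+(m+n)√(4+(m+n)²), f₂ = 4+(m+n)²−(m+n)√(4+(m+n)²), f₃ = 4+(m−n)²+(m−n)√(4+(m−n)²), and f₄ = 4+(m−n)²−(m−n)√(4+(m−n)²). -/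
open Polynomial

/-- A monic quadratic with real roots `4 + s² ± s √(4 + s²)` in expanded form. -/
theorem X_sub_C_mul_X_sub_C_codegree (s : ℝ) :
    (X - C (4 + s ^ 2 + s * Real.sqrt (4 + s ^ 2))) *
      (X - C (4 + s ^ 2 - s * Real.sqrt (4 + s ^ 2))) =
    X ^ 2 - C (8 + 2 * s ^ 2) * X + C (16 + 4 * s ^ 2) := by
  have h : Real.sqrt (4 + s ^ 2) ^ 2 = 4 + s ^ 2 := Real.sq_sqrt (by positivity)
  have hprod : (4 + s ^ 2 + s * Real.sqrt (4 + s ^ 2)) *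
      (4 + s ^ 2 - s * Real.sqrt (4 + s ^ 2)) = 16 + 4 * s ^ 2 := by
    linear_combination (-s ^ 2) * h
  have hsum : (4 + s ^ 2 + s * Real.sqrt (4 + s ^ 2)) +
      (4 + s ^ 2 - s * Real.sqrt (4 + s ^ 2)) = 8 + 2 * s ^ 2 := by ring
  rw [← hprod, ← hsum, C_add (a := 4 + s ^ 2 + _), C_mul (a := 4 + s ^ 2 + _)]
  ring

/-- The characteristic polynomial of a bisymmetric matrix of the shape of `R`, split into its
symmetric and antisymmetric parts. -/
theorem charpoly_codegree_matrix (a b : ℝ) :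
    (!![4, 2 * a, 2 * b, 0;
        2 * a, 2 * b ^ 2 + 2 * a ^ 2 + 4, 4 * a * b, 2 * b;
        2 * b, 4 * a * b, 2 * b ^ 2 + 2 * a ^ 2 + 4, 2 * a;
        0, 2 * b, 2 * a, 4] : Matrix (Fin 4) (Fin 4) ℝ).charpoly =
    (X ^ 2 - C (8 + 2 * (a + b) ^ 2) * X + C (16 + 4 * (a + b) ^ 2)) *
      (X ^ 2 - C (8 + 2 * (a - b) ^ 2) * X + C (16 + 4 * (a - b) ^ 2)) := by
  have hchar : ∀ p q u v w : ℝ, (!![p, q, u, 0; q, v, w, u; u, w, v, q; 0, u, q, p] :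
      Matrix (Fin 4) (Fin 4) ℝ).charmatrix =
      !![X - C p, -C q, -C u, 0; -C q, X - C v, -C w, -C u;
         -C u, -C w, X - C v, -C q; 0, -C u, -C q, X - C p] := by
    intro p q u v w
    ext1 i j
    fin_cases i <;> fin_cases j <;> simp
  rw [Matrix.charpoly, hchar, Matrix.det_succ_row_zero]
  simp only [Fin.sum_univ_four, Matrix.det_fin_three]
  simp [Fin.succAbove, Matrix.submatrix_apply, map_ofNat C]
  ring

/-- The matrix `1 + L_ρ² + L_{αρ}² + L_α²` in explicit form. -/
theorem codegree_matrix_eq (a b : ℝ) :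
    (1 + !![0, 1, 0, 0; 1, a, b, 0; 0, b, a, 1; 0, 0, 1, 0] ^ 2 +
      !![0, 0, 1, 0; 0, b, a, 1; 1, a, b, 0; 0, 1, 0, 0] ^ 2 +
      !![0, 0, 0, 1; 0, 0, 1, 0; 0, 1, 0, 0; 1, 0, 0, 0] ^ 2 : Matrix (Fin 4) (Fin 4) ℝ) =
    !![4, 2 * a, 2 * b, 0;
       2 * a, 2 * b ^ 2 + 2 * a ^ 2 + 4, 4 * a * b, 2 * b;
       2 * b, 4 * a * b, 2 * b ^ 2 + 2 * a ^ 2 + 4, 2 * a;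
       0, 2 * b, 2 * a, 4] := by
  ext i j
  fin_cases i <;> fin_cases j <;> simp [pow_two] <;> ring

/-- The matrix `R = I + L_ρ² + L_{αρ}² + L_α²` built from the fusion matrices of a
`ℤ/2ℤ`-quadratic fusion ring with `ρ² ≅ 1 ⊕ mρ ⊕ nαρ` has the stated form, and its
characteristic polynomial factors with roots the four formal codegrees. -/
theorem stmt_0 (m n : ℕ)
    (Lρ Lαρ Lα R : Matrix (Fin 4) (Fin 4) ℝ)
    (hLρ : Lρ = !![0, 1, 0, 0;
                   1, (m : ℝ), (n : ℝ), 0;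
                   0, (n : ℝ), (m : ℝ), 1;
                   0, 0, 1, 0])
    (hLαρ : Lαρ = !![0, 0, 1, 0;
                     0, (n : ℝ), (m : ℝ), 1;
                     1, (m : ℝ), (n : ℝ), 0;
                     0, 1, 0, 0])
    (hLα : Lα = !![0, 0, 0, 1;
                   0, 0, 1, 0;
                   0, 1, 0, 0;
                   1, 0, 0, 0])
    (hR : R = 1 + Lρ ^ 2 + Lαρ ^ 2 + Lα ^ 2) :
    R = !![4, 2 * (m : ℝ), 2 * (n : ℝ), 0;
           2 * (m : ℝ), 2 * (n : ℝ) ^ 2 + 2 * (m : ℝ) ^ 2 + 4, 4 * (m : ℝ) * (n : ℝ), 2 * (n : ℝ);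
           2 * (n : ℝ), 4 * (m : ℝ) * (n : ℝ), 2 * (n : ℝ) ^ 2 + 2 * (m : ℝ) ^ 2 + 4, 2 * (m : ℝ);
           0, 2 * (n : ℝ), 2 * (m : ℝ), 4] ∧
    R.charpoly =
      (X - C (4 + ((m : ℝ) + n) ^ 2 + ((m : ℝ) + n) * Real.sqrt (4 + ((m : ℝ) + n) ^ 2))) *
      (X - C (4 + ((m : ℝ) + n) ^ 2 - ((m : ℝ) + n) * Real.sqrt (4 + ((m : ℝ) + n) ^ 2))) *
      (X - C (4 + ((m : ℝ) - n) ^ 2 + ((m : ℝ) - n) * Real.sqrt (4 + ((m : ℝ) - n) ^ 2))) *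
      (X - C (4 + ((m : ℝ) - n) ^ 2 - ((m : ℝ) - n) * Real.sqrt (4 + ((m : ℝ) - n) ^ 2))) := by
  rw [hLρ, hLαρ, hLα, codegree_matrix_eq] at hR
  refine ⟨hR, ?_⟩
  rw [hR, charpoly_codegree_matrix, X_sub_C_mul_X_sub_C_codegree, mul_assoc,
    X_sub_C_mul_X_sub_C_codegree]
end

section
/- Let m and n be positive integers with m ≠ n, and set r := √((4+(m+n)²)/(4+(m−n)²)). If r lies in the quadratic field ℚ(√(4+(m+n)²)), i.e., there exist rational numbers p and q with r = p + q·√(4+(m+n)²), then m+n ≥ 11. -/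
/-- If `√(A / B)` lies in `ℚ(√A)` for positive integers `A`, `B`, then one of `A`, `B`, `A * B`
is a perfect square. -/
theorem isSquare_of_sqrt_div_eq_add_mul_sqrt {A B : ℤ} (hA : 0 < A) (hB : 0 < B) {p q : ℚ}
    (h : √((A : ℝ) / B) = p + q * √(A : ℝ)) :
    IsSquare A ∨ IsSquare B ∨ IsSquare (A * B) := by
  have hA' : (0 : ℝ) < A := by exact_mod_cast hA
  have hB' : (0 : ℝ) < B := by exact_mod_cast hB
  have hBq : (B : ℚ) ≠ 0 := by exact_mod_cast hB.ne'
  have hAq : (A : ℚ) ≠ 0 := by exact_mod_cast hA.ne'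
  have hsA : √(A : ℝ) ^ 2 = A := Real.sq_sqrt hA'.le
  have hsq : (A : ℝ) / B = p ^ 2 + q ^ 2 * A + 2 * p * q * √(A : ℝ) := by
    rw [← Real.sq_sqrt (div_pos hA' hB').le, h]
    linear_combination (q : ℝ) ^ 2 * hsA
  by_cases hp : p = 0
  · have hq : (A : ℚ) / B = q ^ 2 * A := by
      subst hp
      have : (A : ℝ) / B = q ^ 2 * A := by simpa using hsq
      exact_mod_cast this
    refine Or.inr (Or.inl (Rat.isSquare_intCast_iff.mp ⟨q * B, ?_⟩))
    rw [div_eq_iff hBq] at hq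
    have hone : q ^ 2 * B = 1 := mul_left_cancel₀ hAq (by linear_combination -hq)
    linear_combination -(B : ℚ) * hone
  by_cases hq : q = 0
  · have hp2 : (A : ℚ) / B = p ^ 2 := by
      subst hq
      have : (A : ℝ) / B = p ^ 2 := by simpa using hsq
      exact_mod_cast this
    refine Or.inr (Or.inr (Rat.isSquare_intCast_iff.mp ⟨p * B, ?_⟩))
    rw [div_eq_iff hBq] at hp2
    push_cast
    linear_combination (B : ℚ) * hp2
  · have hp' : (p : ℝ) ≠ 0 := by exact_mod_cast hp
    have hq' : (q : ℝ) ≠ 0 := by exact_mod_cast hq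
    have hs : √(A : ℝ) = (((A : ℚ) / B - p ^ 2 - q ^ 2 * A) / (2 * p * q) : ℚ) := by
      push_cast
      rw [eq_div_iff (by positivity)]
      linear_combination -hsq
    refine Or.inl (Rat.isSquare_intCast_iff.mp
      ⟨((A : ℚ) / B - p ^ 2 - q ^ 2 * A) / (2 * p * q), ?_⟩)
    rw [hs] at hsA
    rw [← pow_two]
    exact_mod_cast hsA.symm

/-- If `0 ≠ m ≠ n ≠ 0` and `r = √((4+(m+n)²)/(4+(m−n)²))` lies in the quadratic field
`ℚ(√(4+(m+n)²))`, then `m + n ≥ 11`. -/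
theorem stmt_2 (m n : ℕ) (hm : 0 < m) (hn : 0 < n) (hmn : m ≠ n)
    (h : ∃ p q : ℚ,
      Real.sqrt ((4 + ((m : ℝ) + n) ^ 2) / (4 + ((m : ℝ) - n) ^ 2)) =
        (p : ℝ) + (q : ℝ) * Real.sqrt (4 + ((m : ℝ) + n) ^ 2)) :
    11 ≤ m + n := by
  obtain ⟨p, q, h⟩ := h
  have key := isSquare_of_sqrt_div_eq_add_mul_sqrt (A := 4 + ((m : ℤ) + n) ^ 2)
    (B := 4 + ((m : ℤ) - n) ^ 2) (p := p) (q := q) (by positivity) (by positivity)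
    (by push_cast; exact h)
  clear h
  by_contra! hlt
  have hm' : m < 10 := by lia
  have hn' : n < 10 := by lia
  interval_cases m <;> interval_cases n <;> first | lia | (revert key; norm_num)
end

section
/- Let u be a rational number and v an integer. If u + v√2 can be written as a sum of N roots of unity in ℂ, then N ≥ |u| + 2|v|. -/
open Algebra in
/-- The normalized trace of a root of unity has absolute value at most `1`. -/
theorem abs_normalizedTrace_le_one_of_pow_eq_one {K : Type*} [Field K] [CharZero K]
    [Algebra.IsIntegral ℚ K] {z : K} {n : ℕ} (hn : n ≠ 0) (hz : z ^ n = 1) :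
    |normalizedTrace ℚ K z| ≤ 1 := by
  have hint : IsIntegral ℚ z := Algebra.IsIntegral.isIntegral z
  have : FiniteDimensional ℚ (IntermediateField.adjoin ℚ {z}) :=
    IntermediateField.adjoin.finiteDimensional hint
  set E := IntermediateField.adjoin ℚ {z}
  set g : E := IntermediateField.AdjoinSimple.gen ℚ z
  have hg : g ^ n = 1 := Subtype.ext (by simpa [g] using hz)
  have hd : (0 : ℚ) < Module.finrank ℚ E := by exact_mod_cast Module.finrank_pos
  have htr : ‖((trace ℚ E g : ℚ) : ℂ)‖ ≤ Module.finrank ℚ E := by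
    have hsum := trace_eq_sum_embeddings (K := ℚ) (L := E) ℂ (x := g)
    rw [eq_ratCast] at hsum
    rw [hsum, ← AlgHom.card ℚ E ℂ]
    refine (norm_sum_le_of_le _ (n := fun _ ↦ (1 : ℝ)) fun σ _ ↦ ?_).trans_eq (by simp)
    exact (Complex.norm_eq_one_of_pow_eq_one (by rw [← map_pow, hg, map_one]) hn).le
  rw [Complex.norm_ratCast] at htr
  have htrQ : |trace ℚ E g| ≤ Module.finrank ℚ E := by exact_mod_cast htr
  rw [normalizedTrace_def, smul_eq_mul, abs_mul, abs_inv, abs_of_pos hd, inv_mul_le_iff₀ hd,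
    mul_one]
  exact htrQ

/-- The normalized trace of a root of unity of order divisible by `4` vanishes. -/
theorem normalizedTrace_eq_zero_of_four_dvd_orderOf {K : Type*} [Field K] [CharZero K]
    [Algebra.IsIntegral ℚ K] {z : K} (h0 : orderOf z ≠ 0) (h4 : 4 ∣ orderOf z) :
    Algebra.normalizedTrace ℚ K z = 0 := by
  obtain ⟨k, hk⟩ := h4
  have hz : IsPrimitiveRoot z (4 * k) := hk ▸ IsPrimitiveRoot.orderOf z
  have hk0 : 0 < k := by omega
  have hhalf : z ^ (2 * k) = -1 := by
    have hsq : (z ^ (2 * k)) ^ 2 = 1 := by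
      rw [← pow_mul, show 2 * k * 2 = 4 * k by ring, hz.pow_eq_one]
    exact (mul_self_eq_one_iff.mp (by rwa [← sq])).resolve_left
      (hz.pow_ne_one_of_pos_of_lt (by omega) (by omega))
  have hcop : (2 * k + 1).Coprime (4 * k) := by
    have h2 : (2 * k + 1).Coprime 2 := by simp
    have h2k : (2 * k + 1).Coprime (2 * k) := by simp
    rw [show 4 * k = 2 * (2 * k) by ring]
    exact h2.mul_right h2k
  have hneg : IsPrimitiveRoot (-z) (4 * k) := by
    have := hz.pow_of_coprime _ hcop
    rwa [pow_succ, hhalf, neg_one_mul] at this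
  have hmin : minpoly ℚ (-z) = minpoly ℚ z := by
    rw [← Polynomial.cyclotomic_eq_minpoly_rat hz (by omega),
      ← Polynomial.cyclotomic_eq_minpoly_rat hneg (by omega)]
  have heq : Algebra.normalizedTrace ℚ K (-z) = Algebra.normalizedTrace ℚ K z := by
    rw [Algebra.normalizedTrace_minpoly, Algebra.normalizedTrace_minpoly, hmin]
  rw [map_neg] at heq
  linarith

theorem Nat.four_dvd_or_of_four_dvd_lcm {a b : ℕ} (h : 4 ∣ a.lcm b) : 4 ∣ a ∨ 4 ∣ b := by
  have key : ∀ c : ℕ, ¬ 4 ∣ c → ∃ d, c ∣ 2 * d ∧ Odd d := fun c hc ↦ by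
    rcases Nat.even_or_odd' c with ⟨d, rfl | rfl⟩
    · exact ⟨d, dvd_rfl, Nat.odd_iff.mpr (by omega)⟩
    · exact ⟨_, dvd_mul_left _ _, odd_two_mul_add_one d⟩
  by_contra! hab
  obtain ⟨c, hc, hc_odd⟩ := key a hab.1
  obtain ⟨d, hd, hd_odd⟩ := key b hab.2
  have hlcm : a.lcm b ∣ 2 * (c * d) :=
    Nat.lcm_dvd (hc.trans ⟨d, by ring⟩) (hd.trans ⟨c, by ring⟩)
  have h4 := h.trans hlcm
  have := Nat.odd_iff.mp (hc_odd.mul hd_odd)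
  omega

/-- If two roots of unity differ by a factor of order divisible by `4`, at least one of them has
vanishing normalized trace. -/
theorem normalizedTrace_eq_zero_or_of_four_dvd_orderOf {K : Type*} [Field K] [CharZero K]
    [Algebra.IsIntegral ℚ K] {x y g : K} (hx : orderOf x ≠ 0) (hy : orderOf y ≠ 0)
    (hxy : x = y * g) (hg : 4 ∣ orderOf g) :
    Algebra.normalizedTrace ℚ K x = 0 ∨ Algebra.normalizedTrace ℚ K y = 0 := by
  have hpow : g ^ (orderOf x).lcm (orderOf y) = 1 := by
    have h1 := orderOf_dvd_iff_pow_eq_one.mp (Nat.dvd_lcm_left (orderOf x) (orderOf y))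
    have h2 := orderOf_dvd_iff_pow_eq_one.mp (Nat.dvd_lcm_right (orderOf x) (orderOf y))
    have h3 := congrArg (· ^ (orderOf x).lcm (orderOf y)) hxy
    simpa only [mul_pow, h1, h2, one_mul, eq_comm] using h3
  exact (Nat.four_dvd_or_of_four_dvd_lcm (hg.trans (orderOf_dvd_of_pow_eq_one hpow))).imp
    (normalizedTrace_eq_zero_of_four_dvd_orderOf hx)
    (normalizedTrace_eq_zero_of_four_dvd_orderOf hy)

theorem orderOf_eq_eight_of_pow_four_eq_neg_one {K : Type*} [Field K] [CharZero K] {w : K}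
    (hw : w ^ 4 = -1) : orderOf w = 8 := by
  have h : (-1 : K) ≠ 1 := by norm_num
  exact orderOf_eq_prime_pow (p := 2) (n := 2) (by norm_num [hw, h])
    (by norm_num; linear_combination (w ^ 4 - 1) * hw)

theorem orderOf_sq_eq_four_of_pow_four_eq_neg_one {K : Type*} [Field K] [CharZero K] {w : K}
    (hw : w ^ 4 = -1) : orderOf (w ^ 2) = 4 := by
  rw [orderOf_pow' w two_ne_zero, orderOf_eq_eight_of_pow_four_eq_neg_one hw]
  norm_num

/-- For `w` a primitive eighth root of unity, so that `w - w ^ 3` is a square root of `2`, the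
functional `x ↦ T (x * (s + t * (w - w ^ 3)))` with `T` the normalized trace and `s, t = ±1` is
bounded by `1` on roots of unity. -/
theorem abs_normalizedTrace_mul_le_one {K : Type*} [Field K] [CharZero K]
    [Algebra.IsIntegral ℚ K] {w z : K} (hw : w ^ 4 = -1) {n : ℕ} (hn : 0 < n) (hz : z ^ n = 1)
    {s t : ℚ} (hs : |s| = 1) (ht : |t| = 1) :
    |s * Algebra.normalizedTrace ℚ K z
      + t * Algebra.normalizedTrace ℚ K (z * (w - w ^ 3))| ≤ 1 := by
  set T := Algebra.normalizedTrace ℚ K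
  have hw8 : w ^ 8 = 1 := by linear_combination (w ^ 4 - 1) * hw
  have ho8 := orderOf_eq_eight_of_pow_four_eq_neg_one hw
  have ho4 := orderOf_sq_eq_four_of_pow_four_eq_neg_one hw
  have hpow : ∀ j, (z * w ^ j) ^ (n * 8) = 1 := fun j ↦ by
    rw [mul_pow, pow_mul, hz, ← pow_mul, show j * (n * 8) = 8 * (j * n) by ring, pow_mul, hw8]
    simp
  have hord : ∀ j, orderOf (z * w ^ j) ≠ 0 := fun j ↦
    (orderOf_pos_iff.mpr (isOfFinOrder_iff_pow_eq_one.mpr ⟨n * 8, by omega, hpow j⟩)).ne'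
  have hT : ∀ j, |T (z * w ^ j)| ≤ 1 := fun j ↦
    abs_normalizedTrace_le_one_of_pow_eq_one (by omega) (hpow j)
  have h10 : T (z * w ^ 1) = 0 ∨ T (z * w ^ 0) = 0 :=
    normalizedTrace_eq_zero_or_of_four_dvd_orderOf (hord 1) (hord 0) (g := w) (by ring)
      (by rw [ho8]; norm_num)
  have h07 : T (z * w ^ 0) = 0 ∨ T (z * w ^ 7) = 0 :=
    normalizedTrace_eq_zero_or_of_four_dvd_orderOf (hord 0) (hord 7) (g := w)
      (by linear_combination -z * hw8) (by rw [ho8]; norm_num)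
  have h17 : T (z * w ^ 1) = 0 ∨ T (z * w ^ 7) = 0 :=
    normalizedTrace_eq_zero_or_of_four_dvd_orderOf (hord 1) (hord 7) (g := w ^ 2)
      (by linear_combination -z * w * hw8) (by rw [ho4])
  have hsplit : s * T z + t * T (z * (w - w ^ 3))
      = s * T (z * w ^ 0) + t * T (z * w ^ 1) + t * T (z * w ^ 7) := by
    have : z * (w - w ^ 3) = z * w ^ 1 + z * w ^ 7 := by linear_combination -z * w ^ 3 * hw
    rw [this, map_add, pow_zero, mul_one]
    ring
  have hT0 := hT 0
  have hT1 := hT 1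
  have hT7 := hT 7
  rw [hsplit]
  rcases h10 with h | h <;> rcases h07 with hb | hb <;> rcases h17 with hc | hc <;>
    simp_all [abs_mul]

/-- The bound for sums of roots of unity, in a field algebraic over `ℚ` containing a primitive
eighth root of unity `w`. -/
theorem abs_add_two_mul_abs_le_of_sum_eq {K : Type*} [Field K] [CharZero K]
    [Algebra.IsIntegral ℚ K] {w : K} (hw : w ^ 4 = -1) {N : ℕ} {z : Fin N → K}
    (hz : ∀ i, ∃ k : ℕ, 0 < k ∧ z i ^ k = 1) {u v : ℚ}
    (hsum : ∑ i, z i = u + v * (w - w ^ 3)) : |u| + 2 * |v| ≤ N := by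
  set T := Algebra.normalizedTrace ℚ K
  have hsign : ∀ a : ℚ, ∃ s : ℚ, |s| = 1 ∧ s * a = |a| := fun a ↦ by
    rcases abs_choice a with h | h
    · exact ⟨1, by simp, by rw [h, one_mul]⟩
    · exact ⟨-1, by simp, by rw [h, neg_one_mul]⟩
  obtain ⟨s, hs, hsu⟩ := hsign u
  obtain ⟨t, ht, htv⟩ := hsign v
  have hrat : ∀ q : ℚ, T (q : K) = q := fun q ↦ by
    simpa using Algebra.normalizedTrace_algebraMap_apply_eq_self ℚ K q
  have hsqrt : T (w - w ^ 3) = 0 := by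
    have h1 : orderOf w = 8 := orderOf_eq_eight_of_pow_four_eq_neg_one hw
    have h3 : orderOf (w ^ 3) = 8 :=
      orderOf_eq_eight_of_pow_four_eq_neg_one (by linear_combination (w ^ 8 - w ^ 4 + 1) * hw)
    rw [map_sub, normalizedTrace_eq_zero_of_four_dvd_orderOf (by omega) (by omega),
      normalizedTrace_eq_zero_of_four_dvd_orderOf (by omega) (by omega), sub_zero]
  have hmul : ∀ q : ℚ, T (q * (w - w ^ 3)) = 0 := fun q ↦ by
    rw [← Rat.smul_def, map_smul, hsqrt, smul_zero]
  have hval : s * T (∑ i, z i) + t * T ((∑ i, z i) * (w - w ^ 3)) = |u| + 2 * |v| := by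
    have h2 : (u + v * (w - w ^ 3)) * (w - w ^ 3) = u * (w - w ^ 3) + ((2 * v : ℚ) : K) := by
      push_cast
      linear_combination (v : K) * (w ^ 2 - 2) * hw
    rw [hsum, h2, map_add, map_add, hmul, hmul, hrat, hrat]
    linear_combination hsu + 2 * htv
  rw [← hval, Finset.sum_mul, map_sum, map_sum, Finset.mul_sum, Finset.mul_sum,
    ← Finset.sum_add_distrib]
  refine (Finset.sum_le_card_nsmul _ _ 1 fun i _ ↦ ?_).trans_eq (by simp)
  obtain ⟨k, hk, hzk⟩ := hz i
  exact (le_abs_self _).trans (abs_normalizedTrace_mul_le_one hw hk hzk hs ht)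

/-- The complex number `√2` comes from a primitive eighth root of unity. -/
theorem exists_pow_four_eq_neg_one_and_sub_cube_eq_sqrt_two :
    ∃ w : ℂ, w ^ 4 = -1 ∧ w - w ^ 3 = ((Real.sqrt 2 : ℝ) : ℂ) := by
  have h2 : ((Real.sqrt 2 : ℝ) : ℂ) ^ 2 = 2 := by
    exact_mod_cast Real.sq_sqrt (zero_le_two : (0 : ℝ) ≤ 2)
  set r := ((Real.sqrt 2 : ℝ) : ℂ)
  have hI := Complex.I_sq
  have hsq : (r / 2 * (1 + Complex.I)) ^ 2 = Complex.I := by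
    linear_combination (1 + Complex.I) ^ 2 / 4 * h2 + hI / 2
  refine ⟨r / 2 * (1 + Complex.I), ?_, ?_⟩
  · linear_combination ((r / 2 * (1 + Complex.I)) ^ 2 + Complex.I) * hsq + hI
  · linear_combination -(r / 2 * (1 + Complex.I)) * hsq - r / 2 * hI

/-- Larson's bound: it takes at least `|u| + 2|v|` roots of unity to write `u + v√2`
(`u ∈ ℚ`, `v ∈ ℤ`) as a sum of roots of unity. -/
theorem stmt_5 (u : ℚ) (v : ℤ) (N : ℕ) (ζ : Fin N → ℂ)
    (hζ : ∀ i, ∃ k : ℕ, 0 < k ∧ ζ i ^ k = 1)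
    (hsum : ∑ i, ζ i = ((u : ℝ) : ℂ) + ((v : ℝ) : ℂ) * ((Real.sqrt 2 : ℝ) : ℂ)) :
    |(u : ℝ)| + 2 * |(v : ℝ)| ≤ (N : ℝ) := by
  obtain ⟨w, hw, hwr⟩ := exists_pow_four_eq_neg_one_and_sub_cube_eq_sqrt_two
  have hmem : ∀ {x : ℂ} {k : ℕ} {a : ℚ}, 0 < k → x ^ k = algebraMap ℚ ℂ a →
      x ∈ algebraicClosure ℚ ℂ := fun {x k a} hk hx ↦ by
    rw [mem_algebraicClosure_iff']
    exact IsIntegral.of_pow hk (hx ▸ isIntegral_algebraMap)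
  have hζmem : ∀ i, ζ i ∈ algebraicClosure ℚ ℂ := fun i ↦ by
    obtain ⟨k, hk, h⟩ := hζ i
    exact hmem (a := 1) hk (by simpa using h)
  have hwmem : w ∈ algebraicClosure ℚ ℂ := hmem (k := 4) (a := -1) (by norm_num) (by simpa using hw)
  have : Algebra.IsIntegral ℚ (algebraicClosure ℚ ℂ) :=
    Algebra.isAlgebraic_iff_isIntegral.mp (algebraicClosure.isAlgebraic ℚ ℂ)
  have key := abs_add_two_mul_abs_le_of_sum_eq (K := algebraicClosure ℚ ℂ) (w := ⟨w, hwmem⟩)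
    (Subtype.ext (by simpa using hw)) (z := fun i ↦ ⟨ζ i, hζmem i⟩) (u := u) (v := v)
    (fun i ↦ (hζ i).imp fun k hk ↦ ⟨hk.1, Subtype.ext (by simpa using hk.2)⟩)
    (Subtype.ext (by
      push_cast
      rw [hwr, hsum]
      push_cast
      rfl))
  exact_mod_cast key
end

section
/- Let u be a rational number, v an integer, and t a squarefree natural number with t ≥ 2. If u + v√t can be written as a sum of N roots of unity in ℂ, then N ≥ |v|·φ(2t), where φ is Euler's totient function. -/
theorem totient_sq_mul_le (d k : ℕ) (h : Even d ∨ Odd k) :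
    k * d.totient ^ 2 ≤ (d * k).totient ^ 2 := by
  induction k using induction_on_primes generalizing d with
  | zero => simp
  | one => simp
  | prime_mul p k hp ih =>
    have h1 : p * d.totient ^ 2 ≤ (d * p).totient ^ 2 := by
      by_cases hpd : p ∣ d
      · rw [mul_comm d p, Nat.totient_mul_of_prime_of_dvd hp hpd, mul_pow]
        exact Nat.mul_le_mul_right _ (Nat.le_self_pow two_ne_zero p)
      · rw [mul_comm d p, Nat.totient_mul_of_prime_of_not_dvd hp hpd, mul_pow]
        refine Nat.mul_le_mul_right _ ?_
        have : p ≠ 2 := by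
          rintro rfl
          rcases h with h | h
          · exact hpd h.two_dvd
          · exact absurd h (by simp)
        have h2 := hp.two_le
        obtain ⟨q, rfl⟩ : ∃ q, p = q + 3 := ⟨p - 3, by omega⟩
        simp only [show q + 3 - 1 = q + 2 by omega]
        nlinarith
    have h2 := ih (d * p) (by
      rcases h with h | h
      · exact Or.inl (h.mul_right p)
      · exact Or.inr (Nat.odd_mul.1 h).2)
    calc p * k * d.totient ^ 2 = k * (p * d.totient ^ 2) := by ring
      _ ≤ k * (d * p).totient ^ 2 := Nat.mul_le_mul_left _ h1
      _ ≤ _ := by rwa [← mul_assoc]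

theorem mul_totient_two_mul_sq_le {t n : ℕ} (ht : Squarefree t) (htn : t ∣ n) (h8 : 2 ∣ t → 8 ∣ n)
    (h2 : n % 4 ≠ 2) : n * (2 * t).totient ^ 2 ≤ t * n.totient ^ 2 := by
  rcases Nat.even_or_odd t with he | ho
  · obtain ⟨s, rfl⟩ := he.two_dvd
    have hs : Odd s := by
      rw [← Nat.not_even_iff_odd]
      rintro h
      obtain ⟨r, rfl⟩ := h.two_dvd
      have := ht 2 ⟨r, by ring⟩
      simp at this
    obtain ⟨k, rfl⟩ : 8 * s ∣ n := by
      refine Nat.Coprime.mul_dvd_of_dvd_of_dvd ?_ (h8 (by simp)) ((Dvd.intro_left 2 rfl).trans htn)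
      exact (Nat.coprime_two_left.2 hs).pow_left 3
    have h1 := totient_sq_mul_le (2 * (2 * s)) k (Or.inl (by simp))
    have h3 : (8 * s * k).totient = 2 * (2 * (2 * s) * k).totient := by
      rw [← Nat.totient_mul_of_prime_of_dvd Nat.prime_two (by simp [mul_assoc])]
      congr 1; ring
    rw [h3]
    nlinarith
  · obtain ⟨k, rfl⟩ := htn
    rw [Nat.totient_mul_of_prime_of_not_dvd Nat.prime_two (by
      rw [← even_iff_two_dvd, Nat.not_even_iff_odd]; exact ho)]
    simp only [Nat.add_one_sub_one, one_mul]
    rw [mul_assoc]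
    refine Nat.mul_le_mul_left _ ?_
    rcases Nat.even_or_odd k with hk | hk
    · obtain ⟨r, rfl⟩ := hk.two_dvd
      obtain ⟨j, rfl⟩ : 2 ∣ r := by
        rw [← even_iff_two_dvd, ← Nat.not_odd_iff_even]
        intro hr
        obtain ⟨a, ha⟩ := ho.mul hr
        apply h2
        rw [show t * (2 * r) = 2 * (t * r) by ring, ha]
        omega
      have h1 := totient_sq_mul_le (2 * t) j (Or.inl (by simp))
      have h3 : (t * (2 * (2 * j))).totient = 2 * (2 * t * j).totient := by
        rw [← Nat.totient_mul_of_prime_of_dvd Nat.prime_two (by simp [mul_assoc])]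
        congr 1; ring
      rw [Nat.totient_mul_of_prime_of_not_dvd Nat.prime_two (by
        rw [← even_iff_two_dvd, Nat.not_even_iff_odd]; exact ho)] at h1
      rw [h3]
      simp only [Nat.add_one_sub_one, one_mul] at h1
      nlinarith
    · exact totient_sq_mul_le t k (Or.inr hk)

/-- If the quotient of two natural numbers is an algebraic integer, then it is an integer. -/
theorem dvd_of_isIntegral_mul {K : Type*} [Field K] [CharZero K] {a b : ℕ} {w : K}
    (hw : IsIntegral ℤ w) (h : (a : K) = b * w) : b ∣ a := by
  rcases eq_or_ne b 0 with rfl | hb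
  · simp at h; simp [h]
  have hb' : (b : K) ≠ 0 := by exact_mod_cast hb
  have h1 : w = algebraMap ℚ K (a / b) := by
    simp [h, hb']
  rw [h1, isIntegral_algebraMap_iff (algebraMap ℚ K).injective,
    IsIntegrallyClosed.isIntegral_iff] at hw
  obtain ⟨m, hm⟩ := hw
  have hb'' : (b : ℚ) ≠ 0 := by exact_mod_cast hb
  rw [eq_div_iff hb''] at hm
  rw [← Int.natCast_dvd_natCast]
  refine ⟨m, ?_⟩
  have : (m : ℚ) * b = a := by simpa using hm
  have : m * (b : ℤ) = a := by exact_mod_cast this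
  linarith

theorem trace_eq_zero_of_sq_eq {K L : Type*} [Field K] [Field L] [Algebra K L]
    [FiniteDimensional K L] {x : L} {t : K} (hx : x ^ 2 = algebraMap K L t)
    (hn : x ∉ (algebraMap K L).range) : Algebra.trace K L x = 0 := by
  have hmin : minpoly K x = Polynomial.X ^ 2 - Polynomial.C t := by
    symm
    refine minpoly.eq_of_irreducible_of_monic ?_ (by simp [hx])
      (Polynomial.monic_X_pow_sub_C t two_ne_zero)
    refine X_pow_sub_C_irreducible_of_prime Nat.prime_two ?_
    intro b hb
    apply hn
    rw [← hb, map_pow, sq_eq_sq_iff_eq_or_eq_neg] at hx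
    rcases hx with h | h
    · exact ⟨b, h.symm⟩
    · exact ⟨-b, by simp [h]⟩
  rw [trace_eq_finrank_mul_minpoly_nextCoeff, hmin, Polynomial.nextCoeff_of_natDegree_pos] <;>
    simp

section Cyclotomic

open IsCyclotomicExtension

variable {n : ℕ} [NeZero n] {K : Type*} [Field K] [NumberField K] [IsCyclotomicExtension {n} ℚ K]

theorem exists_gal_eq_pow {c : ℕ} (hc : c.Coprime n) :
    ∃ σ : Gal(K/ℚ), ∀ y : K, y ^ n = 1 → σ y = y ^ c := by
  refine ⟨(Rat.galEquivZMod n K).symm (ZMod.unitOfCoprime c hc), fun y hy => ?_⟩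
  rw [Rat.galEquivZMod_apply_of_pow_eq n K _ hy, MulEquiv.apply_symm_apply,
    ZMod.coe_unitOfCoprime, ZMod.val_natCast]
  exact (pow_eq_pow_mod c hy).symm

theorem gal_apply_eq_or_eq_neg {x : K} {t : ℕ} (hx : x ^ 2 = t) (σ : Gal(K/ℚ)) :
    σ x = x ∨ σ x = -x := by
  rw [← sq_eq_sq_iff_eq_or_eq_neg, ← map_pow, hx, map_natCast]

/-- Elements of the ring of integers of a cyclotomic field are integral polynomial expressions
in a primitive root. -/
theorem isIntegral_induction {ζ : K} (hζ : IsPrimitiveRoot ζ n) {P : K → Prop}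
    (h0 : P ζ) (hcast : ∀ m : ℤ, P m)
    (hadd : ∀ a b, IsIntegral ℤ a → IsIntegral ℤ b → P a → P b → P (a + b))
    (hmul : ∀ a b, IsIntegral ℤ a → IsIntegral ℤ b → P a → P b → P (a * b))
    {r : K} (hr : IsIntegral ℤ r) : P r := by
  have := Rat.isIntegralClosure_adjoin_singleton hζ
  obtain ⟨⟨r, hrA⟩, rfl⟩ :=
    (IsIntegralClosure.isIntegral_iff (R := ℤ) (B := K) (A := Algebra.adjoin ℤ ({ζ} : Set K))).1 hr
  have hi : ∀ a ∈ Algebra.adjoin ℤ ({ζ} : Set K), IsIntegral ℤ a := fun a ha =>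
    (IsIntegralClosure.isIntegral_iff (R := ℤ) (B := K) (A := Algebra.adjoin ℤ ({ζ} : Set K))).2 ⟨⟨a, ha⟩, rfl⟩
  change P r
  induction hrA using Algebra.adjoin_induction with
  | mem x hx => rwa [Set.mem_singleton_iff.1 hx]
  | algebraMap m => simpa using hcast m
  | add a b ha hb iha ihb => exact hadd a b (hi a ha) (hi b hb) (iha (hi a ha)) (ihb (hi b hb))
  | mul a b ha hb iha ihb => exact hmul a b (hi a ha) (hi b hb) (iha (hi a ha)) (ihb (hi b hb))

theorem IsIntegral.gal_apply {a : K} (ha : IsIntegral ℤ a) (σ : Gal(K/ℚ)) :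
    IsIntegral ℤ (σ a) :=
  ha.map ((σ : K →+* K).toIntAlgHom)

theorem isIntegral_of_sq_eq {K : Type*} [Field K] {x : K} {t : ℕ} (hx : x ^ 2 = t) : IsIntegral ℤ x :=
  IsIntegral.of_pow two_pos (by rw [hx]; exact isIntegral_natCast t)

theorem prime_dvd_of_sq_eq {x : K} {t p : ℕ} (ht : Squarefree t) (hx : x ^ 2 = t)
    (hp : p.Prime) (hpt : p ∣ t) : p ∣ n := by
  by_contra hpn
  obtain ⟨σ, hσ⟩ := exists_gal_eq_pow (K := K) ((Nat.Prime.coprime_iff_not_dvd hp).2 hpn)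
  have hζ := zeta_spec n ℚ K
  have key : ∀ r : K, IsIntegral ℤ r → ∃ w, IsIntegral ℤ w ∧ r ^ p - σ r = p * w := by
    intro r hr
    refine isIntegral_induction
      (P := fun r => ∃ w, IsIntegral ℤ w ∧ r ^ p - σ r = p * w) hζ ?h0 ?hcast ?hadd ?hmul hr
    case h0 => exact ⟨0, isIntegral_zero, by rw [hσ _ hζ.pow_eq_one]; ring⟩
    case hcast =>
      intro m
      have := Fact.mk hp
      obtain ⟨k, hk⟩ : (p : ℤ) ∣ m ^ p - m := by
        rw [← ZMod.intCast_zmod_eq_zero_iff_dvd]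
        simp
      refine ⟨k, isIntegral_algebraMap (x := k), ?_⟩
      rw [map_intCast]
      exact_mod_cast congrArg (Int.cast : ℤ → K) hk
    case hadd =>
      intro a b ha hb iha ihb
      obtain ⟨u, hu, hu'⟩ := iha
      obtain ⟨v, hv, hv'⟩ := ihb
      obtain ⟨r, hr⟩ := exists_add_pow_prime_eq hp
        (⟨a, ha⟩ : integralClosure ℤ K) (⟨b, hb⟩ : integralClosure ℤ K)
      have hr' : (a + b) ^ p = a ^ p + b ^ p + p * (a * b * (r : K)) := by
        simpa [mul_assoc] using congrArg Subtype.val hr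
      refine ⟨u + v + a * b * (r : K), (hu.add hv).add ((ha.mul hb).mul r.2), ?_⟩
      rw [hr', map_add]
      linear_combination hu' + hv'
    case hmul =>
      intro a b ha hb iha ihb
      obtain ⟨u, hu, hu'⟩ := iha
      obtain ⟨v, hv, hv'⟩ := ihb
      refine ⟨a ^ p * v + u * σ b, ((ha.pow p).mul hv).add (hu.mul (hb.gal_apply σ)), ?_⟩
      rw [map_mul, mul_pow]
      linear_combination a ^ p * hv' + hu' * σ b
  have hxi := isIntegral_of_sq_eq hx
  obtain ⟨w, hw, hw'⟩ := key x hxi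
  obtain ⟨s, rfl⟩ := hpt
  obtain ⟨q, rfl⟩ : ∃ q, p = q + 2 := ⟨p - 2, by have := hp.two_le; omega⟩
  have hpow : x ^ (q + 2) = ((q + 2 : ℕ) : K) * (x ^ q * s) := by
    rw [pow_add, hx]; push_cast; ring
  rw [hpow] at hw'
  have hsq : (σ x) ^ 2 = ((q + 2) * s : ℕ) := by rw [← map_pow, hx, map_natCast]
  have hσx : σ x = ((q + 2 : ℕ) : K) * (x ^ q * s - w) := by linear_combination -hw'
  have hv : IsIntegral ℤ ((x ^ q * s - w) ^ 2) :=
    (((hxi.pow q).mul (isIntegral_natCast s)).sub hw).pow 2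
  have hd : (q + 2) * (q + 2) ∣ (q + 2) * s := by
    refine dvd_of_isIntegral_mul hv ?_
    rw [← hsq, hσx]; push_cast; ring
  have := ht _ hd
  rw [Nat.isUnit_iff] at this
  omega

theorem eight_dvd_of_sq_eq {x : K} {t : ℕ} (ht : Squarefree t) (hx : x ^ 2 = t)
    (h2t : 2 ∣ t) (h4 : 4 ∣ n) : 8 ∣ n := by
  by_contra h8
  obtain ⟨m, rfl⟩ := h4
  have hm : Odd m := by
    rw [← Nat.not_even_iff_odd]
    intro h
    obtain ⟨k, rfl⟩ := h.two_dvd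
    exact h8 ⟨k, by ring⟩
  have hζ := zeta_spec (4 * m) ℚ K
  set ζ := zeta (4 * m) ℚ K
  have hI : (ζ ^ m) ^ 2 = -1 := by
    have := hζ.pow (by omega) (show 4 * m = (2 * m) * 2 by ring)
    rw [← pow_mul, mul_comm m 2]
    exact this.eq_neg_one_of_two_right
  obtain ⟨σ, hσ⟩ := exists_gal_eq_pow (K := K) (n := 4 * m) (c := 1 + 2 * m) (by
    refine Nat.Coprime.mul_right ?_ ?_
    · exact Nat.Coprime.pow_right 2 (Nat.coprime_two_right.2 ⟨m, by ring⟩)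
    · simp)
  have hσζ : σ ζ = -ζ := by
    rw [hσ _ hζ.pow_eq_one, pow_add, mul_comm 2 m, pow_mul, hI]; ring
  have key : ∀ r : K, IsIntegral ℤ r → ∃ w, IsIntegral ℤ w ∧ r - σ r = 2 * w := by
    intro r hr
    refine isIntegral_induction
      (P := fun r => ∃ w, IsIntegral ℤ w ∧ r - σ r = 2 * w) hζ ?h0 ?hcast ?hadd ?hmul hr
    case h0 => exact ⟨ζ, hζ.isIntegral (by omega), by rw [hσζ]; ring⟩
    case hcast =>
      intro m
      exact ⟨0, isIntegral_zero, by simp⟩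
    case hadd =>
      intro a b ha hb iha ihb
      obtain ⟨u, hu, hu'⟩ := iha
      obtain ⟨v, hv, hv'⟩ := ihb
      exact ⟨u + v, hu.add hv, by rw [map_add]; linear_combination hu' + hv'⟩
    case hmul =>
      intro a b ha hb iha ihb
      obtain ⟨u, hu, hu'⟩ := iha
      obtain ⟨v, hv, hv'⟩ := ihb
      refine ⟨a * v + u * σ b, (ha.mul hv).add (hu.mul (hb.gal_apply σ)), ?_⟩
      rw [map_mul]
      linear_combination a * hv' + hu' * σ b
  obtain ⟨s, rfl⟩ := h2t
  have hσI : σ (ζ ^ m) = - ζ ^ m := by rw [map_pow, hσζ, hm.neg_pow]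
  have hIi : IsIntegral ℤ (ζ ^ m) := (hζ.isIntegral (by omega)).pow m
  generalize ζ ^ m = I at hI hσI hIi
  push_cast at hx
  -- `y = x / (1 + I)` is integral
  obtain ⟨y, hy⟩ : ∃ y, y = x * (1 - I) / 2 := ⟨_, rfl⟩
  have hy2 : y ^ 2 = -(I * s) := by
    rw [hy]; linear_combination (1 - I) ^ 2 / 4 * hx + (s : K) / 2 * hI
  have hyi : IsIntegral ℤ y := IsIntegral.of_pow two_pos (by
    rw [hy2]; exact (hIi.mul (isIntegral_natCast s)).neg)
  obtain ⟨w, hw, hw'⟩ := key y hyi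
  have hσy : σ y = σ x * (1 + I) / 2 := by
    rw [hy]; simp [hσI, map_ofNat]
  have hx' : x ^ 2 = ((2 * s : ℕ) : K) := by rw [hx]; push_cast; ring
  have hfin : ∃ v, IsIntegral ℤ v ∧ ((2 * s : ℕ) : K) = (2 * 2 : ℕ) * v := by
    rcases gal_apply_eq_or_eq_neg hx' σ with h | h
    · refine ⟨-w ^ 2, (hw.pow 2).neg, ?_⟩
      rw [hσy, h, hy] at hw'
      have : x * I = - (2 * w) := by linear_combination -hw'
      push_cast
      linear_combination -hx + x ^ 2 * hI - (x * I - 2 * w) * this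
    · refine ⟨w ^ 2, hw.pow 2, ?_⟩
      rw [hσy, h, hy] at hw'
      have : x = 2 * w := by linear_combination hw'
      push_cast
      rw [← hx, this]; ring
  obtain ⟨v, hv, hv'⟩ := hfin
  have := ht 2 (dvd_of_isIntegral_mul hv hv')
  simp at this

/-- Parseval's identity for the traces of `ζ ^ b * x` bounds the trace of `ζ * x`. -/
theorem trace_mul_sq_le {x ζ : K} {t : ℕ} (hx : x ^ 2 = t) (hζ : IsPrimitiveRoot ζ n) :
    (Algebra.trace ℚ K (ζ * x)) ^ 2 ≤ n * t := by
  have : IsGalois ℚ K := IsCyclotomicExtension.isGalois {n} ℚ K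
  have hn : 0 < n := NeZero.pos n
  have hζ0 : ζ ≠ 0 := hζ.ne_zero hn.ne'
  set a : ℕ → ℚ := fun b => Algebra.trace ℚ K (ζ ^ b * x) with ha
  have hgal : ∀ (σ : Gal(K/ℚ)) (y : K), Algebra.trace ℚ K (σ y) = Algebra.trace ℚ K y :=
    fun σ y => Algebra.trace_eq_of_algEquiv σ y
  have hsign : ∀ σ : Gal(K/ℚ), ∃ κ : ℚ, κ ^ 2 = 1 ∧
      ∀ y, Algebra.trace ℚ K (σ y * x) = κ * Algebra.trace ℚ K (y * x) := by
    intro σ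
    rcases gal_apply_eq_or_eq_neg hx σ with h | h
    · refine ⟨1, by norm_num, fun y => ?_⟩
      rw [← hgal σ (y * x), map_mul σ, h, one_mul]
    · refine ⟨-1, by norm_num, fun y => ?_⟩
      rw [← hgal σ (y * x), map_mul σ, h, mul_neg, map_neg]; ring
  have hcop : ∀ b, n.Coprime b → a b ^ 2 = a 1 ^ 2 := by
    intro b hb
    obtain ⟨σ, hσ⟩ := exists_gal_eq_pow (K := K) hb.symm
    obtain ⟨κ, hκ, h⟩ := hsign σ
    have := h ζ
    rw [hσ _ hζ.pow_eq_one] at this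
    simp only [ha]
    rw [this, mul_pow, hκ, one_mul, pow_one]
  have hinv : ∃ κ : ℚ, κ ^ 2 = 1 ∧ ∀ b, Algebra.trace ℚ K ((ζ⁻¹) ^ b * x) = κ * a b := by
    obtain ⟨σ, hσ⟩ := exists_gal_eq_pow (K := K) (n := n) (c := n - 1) (by
      obtain ⟨m, rfl⟩ : ∃ m, n = m + 1 := ⟨n - 1, by omega⟩
      simp)
    obtain ⟨κ, hκ, h⟩ := hsign σ
    refine ⟨κ, hκ, fun b => ?_⟩
    rw [← h, map_pow, hσ _ hζ.pow_eq_one]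
    congr 3
    refine inv_eq_of_mul_eq_one_right ?_
    rw [← pow_succ', Nat.sub_add_cancel hn, hζ.pow_eq_one]
  obtain ⟨κ, hκ, hinv⟩ := hinv
  have hcard : (Fintype.card Gal(K/ℚ)) = n.totient := by
    rw [← Nat.card_eq_fintype_card, IsGalois.card_aut_eq_finrank, Rat.finrank n K]
  have hpars : κ * ∑ b ∈ Finset.range n, a b ^ 2 = n * n.totient * t := by
    apply (algebraMap ℚ K).injective
    have h1 : κ * ∑ b ∈ Finset.range n, a b ^ 2 = ∑ b ∈ Finset.range n,
        Algebra.trace ℚ K (ζ ^ b * x) * Algebra.trace ℚ K ((ζ⁻¹) ^ b * x) := by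
      rw [Finset.mul_sum]
      refine Finset.sum_congr rfl fun b _ => ?_
      rw [hinv]; ring
    rw [h1, map_sum]
    simp only [map_mul, trace_eq_sum_automorphisms, map_natCast, Finset.sum_mul_sum, map_pow,
      map_inv₀]
    rw [Finset.sum_comm]
    have h2 : ∀ σ : Gal(K/ℚ), ∑ b ∈ Finset.range n, ∑ τ : Gal(K/ℚ),
        (σ ζ ^ b * σ x) * ((τ ζ)⁻¹ ^ b * τ x) = n * t := by
      intro σ
      rw [Finset.sum_comm, Finset.sum_eq_single σ]
      · have : ∀ b, (σ ζ ^ b * σ x) * ((σ ζ)⁻¹ ^ b * σ x) = t := by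
          intro b
          have h0 : σ ζ ≠ 0 := by simpa using hζ0
          have h3 : σ x ^ 2 = t := by rw [← map_pow, hx, map_natCast]
          have h4 : σ ζ ^ b * (σ ζ)⁻¹ ^ b = 1 := by rw [← mul_pow, mul_inv_cancel₀ h0, one_pow]
          linear_combination (σ x) ^ 2 * h4 + h3
        simp only [this, Finset.sum_const, Finset.card_range, nsmul_eq_mul]
      · intro τ _ hτ
        have h0 : τ ζ ≠ 0 := by simpa using hζ0
        have hne : σ ζ * (τ ζ)⁻¹ ≠ 1 := by
          intro h
          rw [← div_eq_mul_inv, div_eq_one_iff_eq h0] at h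
          apply hτ
          have hpb : (τ : K →ₐ[ℚ] K) = σ :=
            (hζ.powerBasis ℚ).algHom_ext (by simpa using h.symm)
          ext y
          exact DFunLike.congr_fun hpb y
        have hpow : (σ ζ * (τ ζ)⁻¹) ^ n = 1 := by
          rw [mul_pow, inv_pow, ← map_pow, ← map_pow, hζ.pow_eq_one]; simp
        have hgeom : ∑ b ∈ Finset.range n, (σ ζ * (τ ζ)⁻¹) ^ b = 0 := by
          rw [geom_sum_eq hne, hpow]; simp
        calc _ = (∑ b ∈ Finset.range n, (σ ζ * (τ ζ)⁻¹) ^ b) * (σ x * τ x) := by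
              rw [Finset.sum_mul]
              refine Finset.sum_congr rfl fun b _ => ?_
              rw [mul_pow]; ring
          _ = 0 := by rw [hgeom, zero_mul]
      · simp
    simp only [h2, Finset.sum_const, Finset.card_univ, hcard, nsmul_eq_mul]
    ring
  have hle : (n.totient : ℚ) * a 1 ^ 2 ≤ ∑ b ∈ Finset.range n, a b ^ 2 := by
    calc (n.totient : ℚ) * a 1 ^ 2 = ∑ b ∈ Finset.range n with n.Coprime b, a b ^ 2 := by
          rw [Finset.sum_congr rfl (g := fun _ => a 1 ^ 2)
            (fun b hb => hcop b (Finset.mem_filter.1 hb).2), Finset.sum_const, nsmul_eq_mul]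
          rfl
      _ ≤ _ := Finset.sum_le_sum_of_subset_of_nonneg (Finset.filter_subset _ _)
          (fun _ _ _ => sq_nonneg _)
  have hκle : ∑ b ∈ Finset.range n, a b ^ 2 ≤ n * n.totient * t := by
    have hS : 0 ≤ ∑ b ∈ Finset.range n, a b ^ 2 := Finset.sum_nonneg fun _ _ => sq_nonneg _
    rcases sq_eq_sq_iff_eq_or_eq_neg.1 (hκ.trans (one_pow 2).symm) with h | h
    · rw [← hpars, h, one_mul]
    · rw [h] at hpars
      have : (0 : ℚ) ≤ n * n.totient * t := by positivity
      linarith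
  have hφ : (0 : ℚ) < n.totient := by exact_mod_cast Nat.totient_pos.2 hn
  have h1 : a 1 = Algebra.trace ℚ K (ζ * x) := by simp [ha]
  rw [← h1]
  refine le_of_mul_le_mul_left ?_ hφ
  calc _ ≤ _ := hle.trans hκle
    _ = _ := by ring

end Cyclotomic

section NumberField

open IsCyclotomicExtension

variable {L : Type*} [Field L] [NumberField L]

theorem totient_sq_mul_trace_sq_le {n : ℕ} [NeZero n] {ζ x : L} (hζ : IsPrimitiveRoot ζ n)
    (hn : n % 4 ≠ 2) {t : ℕ} (ht : Squarefree t) (hx : x ^ 2 = t) :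
    (2 * t).totient ^ 2 * Algebra.trace ℚ L (ζ * x) ^ 2 ≤ Module.finrank ℚ L ^ 2 * (t : ℚ) ^ 2 := by
  let F := IntermediateField.adjoin ℚ {ζ}
  have hcyc : IsCyclotomicExtension {n} ℚ F := hζ.intermediateField_adjoin_isCyclotomicExtension ℚ
  obtain ⟨z, hz⟩ : ∃ z : F, algebraMap F L z = ζ :=
    ⟨⟨ζ, IntermediateField.mem_adjoin_simple_self ℚ ζ⟩, rfl⟩
  have hzp : IsPrimitiveRoot z n := by
    rw [← hz] at hζ
    exact hζ.of_map_of_injective (algebraMap F L).injective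
  rw [← Algebra.trace_trace (S := F), ← hz, ← Algebra.smul_def, map_smul]
  by_cases hxF : x ∈ (algebraMap F L).range
  · obtain ⟨y, rfl⟩ := hxF
    have hy : y ^ 2 = t := by
      apply (algebraMap F L).injective
      rw [map_pow, hx, map_natCast]
    have htn : t ∣ n := by
      rw [← Nat.prod_primeFactors_of_squarefree ht]
      refine Finset.prod_primes_dvd n (fun p hp => (Nat.prime_of_mem_primeFactors hp).prime)
        fun p hp => ?_
      exact prime_dvd_of_sq_eq ht hy (Nat.prime_of_mem_primeFactors hp)
        (Nat.dvd_of_mem_primeFactors hp)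
    have h8 : 2 ∣ t → 8 ∣ n := by
      intro h
      have h2 := prime_dvd_of_sq_eq (n := n) ht hy Nat.prime_two h
      exact eight_dvd_of_sq_eq ht hy h (by omega)
    have hle := trace_mul_sq_le hy hzp
    have harith := mul_totient_two_mul_sq_le ht htn h8 hn
    have harith' : (n : ℚ) * (2 * t).totient ^ 2 ≤ t * n.totient ^ 2 := by exact_mod_cast harith
    rw [Algebra.trace_algebraMap, ← Module.finrank_mul_finrank ℚ F L, Rat.finrank n F,
      smul_comm, map_nsmul, nsmul_eq_mul, smul_eq_mul]
    set T := Algebra.trace ℚ F (z * y)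
    push_cast
    generalize (Module.finrank F L : ℚ) = D
    calc ((2 * t).totient : ℚ) ^ 2 * (D * T) ^ 2 = (D ^ 2 * (2 * t).totient ^ 2) * T ^ 2 := by ring
      _ ≤ (D ^ 2 * (2 * t).totient ^ 2) * (n * t) := by gcongr
      _ = D ^ 2 * t * (n * (2 * t).totient ^ 2) := by ring
      _ ≤ D ^ 2 * t * (t * n.totient ^ 2) := by gcongr
      _ = _ := by ring
  · rw [trace_eq_zero_of_sq_eq (t := (t : F)) (by rw [hx, map_natCast]) hxF]
    simp
    positivity

theorem totient_mul_abs_trace_le {m : ℕ} (hm : 0 < m) {ζ x : L} (hζ : ζ ^ m = 1)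
    {t : ℕ} (ht : Squarefree t) (hx : x ^ 2 = t) :
    (2 * t).totient * |Algebra.trace ℚ L (ζ * x)| ≤ Module.finrank ℚ L * (t : ℚ) := by
  refine abs_le_of_sq_le_sq' ?_ (by positivity) |>.2
  rw [mul_pow, mul_pow, sq_abs]
  have hpos : 0 < orderOf ζ := orderOf_pos_iff.2 (isOfFinOrder_iff_pow_eq_one.2 ⟨m, hm, hζ⟩)
  by_cases h2 : orderOf ζ % 4 = 2
  · obtain ⟨k, hk⟩ : ∃ k, orderOf ζ = 2 * k := ⟨orderOf ζ / 2, by omega⟩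
    have hkodd : Odd k := by rw [Nat.odd_iff]; omega
    have : NeZero k := ⟨by omega⟩
    have hneg : -ζ = ζ ^ (k + 1) := by
      have := (IsPrimitiveRoot.orderOf ζ).pow hpos (show orderOf ζ = k * 2 by omega)
      rw [pow_succ, this.eq_neg_one_of_two_right]; ring
    have hord : IsPrimitiveRoot (-ζ) k := by
      rw [hneg]
      have h := (IsPrimitiveRoot.orderOf ζ).pow hpos hk
      obtain ⟨j, hj⟩ := hkodd.add_one.two_dvd
      rw [hj, pow_mul]
      exact h.pow_of_coprime j (Nat.Coprime.coprime_dvd_left (Dvd.intro_left 2 hj.symm)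
        (by simp))
    have := totient_sq_mul_trace_sq_le hord (by have := Nat.odd_iff.1 hkodd; omega) ht hx
    rwa [neg_mul, map_neg, neg_sq] at this
  · have : NeZero (orderOf ζ) := ⟨hpos.ne'⟩
    exact totient_sq_mul_trace_sq_le (IsPrimitiveRoot.orderOf ζ) h2 ht hx

theorem abs_mul_totient_le_of_sum_eq {u : ℚ} {v : ℤ} {t : ℕ} (ht : Squarefree t) (ht2 : 2 ≤ t)
    {N : ℕ} {ζ : Fin N → L} (hζ : ∀ i, ∃ k : ℕ, 0 < k ∧ ζ i ^ k = 1) {x : L} (hx : x ^ 2 = t)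
    (hsum : ∑ i, ζ i = algebraMap ℚ L u + v * x) :
    |(v : ℚ)| * (2 * t).totient ≤ N := by
  have hD : (0 : ℚ) < Module.finrank ℚ L := by exact_mod_cast Module.finrank_pos
  have ht0 : (0 : ℚ) < t := by exact_mod_cast (by omega : 0 < t)
  have hxtr : Algebra.trace ℚ L x = 0 := by
    refine trace_eq_zero_of_sq_eq (t := (t : ℚ)) (by rw [hx, map_natCast]) ?_
    rintro ⟨q, rfl⟩
    have hi := isIntegral_of_sq_eq hx
    rw [isIntegral_algebraMap_iff (algebraMap ℚ L).injective,
      IsIntegrallyClosed.isIntegral_iff] at hi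
    obtain ⟨m, rfl⟩ := hi
    have h : (m.natAbs * m.natAbs : ℕ) = t := by
      have : m ^ 2 = t := by
        have : ((m : ℤ) : L) ^ 2 = t := by simpa using hx
        exact_mod_cast this
      zify
      rw [← this, abs_mul_abs_self, sq]
    have h1 := ht _ ⟨1, by rw [h, mul_one]⟩
    rw [Nat.isUnit_iff] at h1
    rw [h1] at h
    omega
  have htr : ∑ i, Algebra.trace ℚ L (ζ i * x) = v * (Module.finrank ℚ L * t) := by
    rw [← map_sum, ← Finset.sum_mul, hsum]
    have : (algebraMap ℚ L u + v * x) * x = u • x + algebraMap ℚ L (v * t) := by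
      rw [Algebra.smul_def, map_mul, map_intCast, map_natCast, ← hx]; ring
    rw [this, map_add, map_smul, hxtr, Algebra.trace_algebraMap, nsmul_eq_mul]
    simp; ring
  refine le_of_mul_le_mul_right ?_ (mul_pos hD ht0)
  calc |(v : ℚ)| * (2 * t).totient * (Module.finrank ℚ L * t)
      = (2 * t).totient * |∑ i, Algebra.trace ℚ L (ζ i * x)| := by
        rw [htr, abs_mul, abs_of_pos (mul_pos hD ht0)]; ring
    _ ≤ (2 * t).totient * ∑ i, |Algebra.trace ℚ L (ζ i * x)| := by
        gcongr; exact Finset.abs_sum_le_sum_abs _ _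
    _ = ∑ i, (2 * t).totient * |Algebra.trace ℚ L (ζ i * x)| := Finset.mul_sum _ _ _
    _ ≤ ∑ _i : Fin N, Module.finrank ℚ L * (t : ℚ) := by
        refine Finset.sum_le_sum fun i _ => ?_
        obtain ⟨k, hk, hk'⟩ := hζ i
        exact totient_mul_abs_trace_le hk hk' ht hx
    _ = N * (Module.finrank ℚ L * t) := by simp

end NumberField

/-- Larson's bound: for `t ≥ 2` squarefree, it takes at least `|v|·φ(2t)` roots of unity to
write `u + v√t` (`u ∈ ℚ`, `v ∈ ℤ`) as a sum of roots of unity. -/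
theorem stmt_6 (u : ℚ) (v : ℤ) (t : ℕ) (ht : Squarefree t) (ht2 : 2 ≤ t)
    (N : ℕ) (ζ : Fin N → ℂ)
    (hζ : ∀ i, ∃ k : ℕ, 0 < k ∧ ζ i ^ k = 1)
    (hsum : ∑ i, ζ i = ((u : ℝ) : ℂ) + ((v : ℝ) : ℂ) * ((Real.sqrt t : ℝ) : ℂ)) :
    |(v : ℝ)| * (Nat.totient (2 * t) : ℝ) ≤ (N : ℝ) := by
  have hsq : ((Real.sqrt t : ℝ) : ℂ) ^ 2 = t := by
    rw [← Complex.ofReal_pow, Real.sq_sqrt (Nat.cast_nonneg t), Complex.ofReal_natCast]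
  let S : Set ℂ := insert ((Real.sqrt t : ℝ) : ℂ) (Set.range ζ)
  let L := IntermediateField.adjoin ℚ S
  have hfd : FiniteDimensional ℚ L := by
    have : Finite S := (Set.finite_range ζ).insert _
    refine IntermediateField.finiteDimensional_adjoin fun y hy => ?_
    rcases hy with rfl | ⟨i, rfl⟩
    · exact IsIntegral.of_pow two_pos (by rw [hsq]; exact isIntegral_natCast t)
    · obtain ⟨k, hk, hk'⟩ := hζ i
      exact IsIntegral.of_pow hk (by rw [hk']; exact isIntegral_one)
  have hnf : NumberField L := ⟨⟩
  let z : Fin N → L := fun i =>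
    ⟨ζ i, IntermediateField.subset_adjoin ℚ S (Set.mem_insert_of_mem _ ⟨i, rfl⟩)⟩
  let x : L := ⟨(Real.sqrt t : ℝ), IntermediateField.subset_adjoin ℚ S (Set.mem_insert _ _)⟩
  have h := abs_mul_totient_le_of_sum_eq (L := L) (u := u) (v := v) (ζ := z) (x := x) ht ht2
    (fun i => by
      obtain ⟨k, hk, hk'⟩ := hζ i
      exact ⟨k, hk, Subtype.ext (by simpa [z] using hk')⟩)
    (Subtype.ext (by simpa [x] using hsq))
    (Subtype.ext (by simpa [x, z] using hsum))
  exact_mod_cast h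
end

section
/- For every natural number t with t ∉ {1, 2, 3, 6}, Euler's totient function satisfies φ(2t) ≥ √(16t/5). -/
theorem prime_sub_one_mul_totient_le {p : ℕ} (hp : p.Prime) (m : ℕ) :
    (p - 1) * Nat.totient m ≤ Nat.totient (p * m) := by
  simpa [Nat.totient_prime hp] using Nat.totient_super_multiplicative p m

theorem le_totient_two_mul_sq (t : ℕ) : t ≤ Nat.totient (2 * t) ^ 2 := by
  induction t using induction_on_primes with
  | zero => simp
  | one => simp
  | prime_mul p s hp ih =>
    rw [mul_left_comm]
    rcases hp.two_le.eq_or_lt with rfl | h3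
    · rw [Nat.totient_two_mul_of_even (even_two_mul s)]
      nlinarith
    · have hle := Nat.pow_le_pow_left (prime_sub_one_mul_totient_le hp (2 * s)) 2
      obtain ⟨q, rfl⟩ : ∃ q, p = q + 1 := ⟨p - 1, by omega⟩
      rw [Nat.add_sub_cancel, mul_pow] at hle
      have hq : q + 1 ≤ q ^ 2 := by nlinarith
      exact (Nat.mul_le_mul hq ih).trans hle

theorem dvd_six_of_forall_prime_lt_five {t : ℕ} (h4 : ¬ 4 ∣ t) (h9 : ¬ 9 ∣ t)
    (hp : ∀ p : ℕ, p.Prime → p ∣ t → p < 5) : t ∣ 6 := by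
  obtain ⟨m, hm⟩ := Nat.gcd_dvd_left t 6
  suffices m = 1 by
    rw [this, mul_one] at hm
    exact Nat.gcd_eq_left_iff_dvd.mp hm.symm
  by_contra hne
  obtain ⟨p, hpp, hpm⟩ := Nat.exists_prime_and_dvd hne
  have hpt : p ∣ t := hm ▸ hpm.mul_left _
  have hlt := hp p hpp hpt
  have hsq : p ∣ 6 → p * p ∣ t := fun h6 => by
    rw [hm]
    exact mul_dvd_mul (Nat.dvd_gcd hpt h6) hpm
  interval_cases p
  · exact Nat.not_prime_zero hpp
  · exact Nat.not_prime_one hpp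
  · exact h4 (hsq (by norm_num))
  · exact h9 (hsq (by norm_num))
  · exact h4 hpt

theorem sixteen_mul_le_five_mul_totient_two_mul_sq {t : ℕ} (h : ¬ t ∣ 6) :
    16 * t ≤ 5 * Nat.totient (2 * t) ^ 2 := by
  by_cases h4 : 4 ∣ t
  · obtain ⟨s, rfl⟩ := h4
    have hs := le_totient_two_mul_sq s
    rw [show 2 * (4 * s) = 2 * (2 * (2 * s)) by ring,
      Nat.totient_two_mul_of_even (even_two_mul _), Nat.totient_two_mul_of_even (even_two_mul _)]
    nlinarith
  by_cases h9 : 9 ∣ t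
  · obtain ⟨s, rfl⟩ := h9
    have hs := le_totient_two_mul_sq s
    rw [show 2 * (9 * s) = 3 * (3 * (2 * s)) by ring,
      Nat.totient_mul_of_prime_of_dvd Nat.prime_three (dvd_mul_right _ _)]
    have hle := Nat.pow_le_pow_left (prime_sub_one_mul_totient_le Nat.prime_three (2 * s)) 2
    norm_num [mul_pow] at hle ⊢
    omega
  obtain ⟨p, hp, ⟨s, rfl⟩, h5⟩ : ∃ p : ℕ, p.Prime ∧ p ∣ t ∧ 5 ≤ p := by
    by_contra! hsmall
    exact h (dvd_six_of_forall_prime_lt_five h4 h9 hsmall)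
  rw [mul_left_comm 2 p s]
  have hle := Nat.pow_le_pow_left (prime_sub_one_mul_totient_le hp (2 * s)) 2
  obtain ⟨q, rfl⟩ : ∃ q, p = q + 1 := ⟨p - 1, by omega⟩
  rw [Nat.add_sub_cancel, mul_pow] at hle
  have hq : 16 * (q + 1) ≤ 5 * q ^ 2 := by nlinarith
  have hmul := Nat.mul_le_mul hq (le_totient_two_mul_sq s)
  linarith

/-- For every natural number `t ∉ {1, 2, 3, 6}`, `φ(2t) ≥ √(16t/5)`. -/
theorem stmt_7 (t : ℕ) (ht : t ∉ ({1, 2, 3, 6} : Set ℕ)) :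
    Real.sqrt (16 * (t : ℝ) / 5) ≤ (Nat.totient (2 * t) : ℝ) := by
  have h6 : ¬ t ∣ 6 := fun hd => by
    have hle := Nat.le_of_dvd (by norm_num) hd
    interval_cases t <;> simp_all
  rw [Real.sqrt_le_left (Nat.cast_nonneg _)]
  have h : (16 * t : ℝ) ≤ 5 * (Nat.totient (2 * t) : ℝ) ^ 2 := by
    exact_mod_cast sixteen_mul_le_five_mul_totient_two_mul_sq h6
  linarith
end

section
/- Let s and c be positive integers and u a rational number. If u + 2c√(4+s²) can be written as a sum of N roots of unity in ℂ, then N ≥ 2c√(2(4+s²)). -/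
theorem four_mul_le_totient_sq_of_odd (n : ℕ) (hn : Odd n) :
    4 * n ≤ n.totient ^ 2 ∨ n = 1 ∨ n = 3 ∨ n = 5 := by
  induction n using Nat.recOnPosPrimePosCoprime with
  | zero => simp at hn
  | one => simp
  | prime_pow p k hp hk =>
    obtain ⟨k, rfl⟩ : ∃ m, k = m + 1 := ⟨k - 1, by omega⟩
    have hpo : Odd p := (Nat.odd_pow_iff (by omega)).1 hn
    rw [Nat.totient_prime_pow_succ hp]
    have h3 : 3 ≤ p := by
      have := hp.two_le
      obtain ⟨r, rfl⟩ := hpo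
      omega
    obtain ⟨q, rfl⟩ : ∃ q, p = q + 3 := ⟨p - 3, by omega⟩
    have e : q + 3 - 1 = q + 2 := by omega
    rw [e]
    rcases k with _ | k
    · by_cases hq : q ≤ 3
      · interval_cases q <;> revert hpo <;> decide
      · left
        simp only [pow_zero, zero_add, pow_one, one_mul]
        nlinarith
    · left
      have h1 : 1 ≤ (q + 3) ^ k := Nat.one_le_pow _ _ (by omega)
      have h2 : (q + 3) ^ k ≤ (q + 3) ^ k * (q + 3) ^ k := Nat.le_mul_of_pos_left _ h1
      have h4 : 4 ≤ (q + 2) ^ 2 := by nlinarith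
      calc 4 * (q + 3) ^ (k + 1 + 1) = 4 * ((q + 3) ^ k * (q + 3) ^ 2) := by ring
        _ ≤ (q + 2) ^ 2 * (((q + 3) ^ k * (q + 3) ^ k) * (q + 3) ^ 2) := by gcongr
        _ = _ := by ring
  | coprime a b ha hb hab iha ihb =>
    obtain ⟨hoa, hob⟩ := Nat.odd_mul.1 hn
    rw [Nat.totient_mul hab, mul_pow]
    have key : ∀ m : ℕ, 4 * m ≤ m.totient ^ 2 ∨ m = 1 ∨ m = 3 ∨ m = 5 →
        m ≤ m.totient ^ 2 := by
      rintro m (h | rfl | rfl | rfl)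
      · omega
      all_goals decide
    have ka := key a (iha hoa)
    have kb := key b (ihb hob)
    rcases iha hoa with h | h
    · left
      nlinarith [Nat.mul_le_mul h kb]
    rcases ihb hob with h' | h'
    · left
      nlinarith [Nat.mul_le_mul ka h']
    rcases h with rfl | rfl | rfl <;> rcases h' with rfl | rfl | rfl <;> revert hab <;> decide

theorem two_mul_le_totient_sq (n : ℕ) (hn : n ≠ 0) :
    2 * n ≤ n.totient ^ 2 ∨ n = 10 ∨ n ∈ ({1, 2, 3, 4, 6, 12} : Finset ℕ) := by
  obtain ⟨a, m, hm, rfl⟩ := Nat.exists_eq_two_pow_mul_odd hn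
  have hc : Nat.Coprime (2 ^ a) m := Nat.Coprime.pow_left _ hm.coprime_two_left
  rw [Nat.totient_mul hc, mul_pow]
  match a with
  | 0 =>
    rcases four_mul_le_totient_sq_of_odd m hm with h | rfl | rfl | rfl
    · left; simp; omega
    all_goals decide
  | 1 =>
    rcases four_mul_le_totient_sq_of_odd m hm with h | rfl | rfl | rfl
    · left; simp; omega
    all_goals decide
  | 2 =>
    rcases four_mul_le_totient_sq_of_odd m hm with h | rfl | rfl | rfl
    · left
      have : Nat.totient (2 ^ 2) = 2 := by decide
      rw [this]; omega
    all_goals decide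
  | a + 3 =>
    left
    rw [Nat.totient_prime_pow_succ Nat.prime_two]
    have h1 : 1 ≤ 2 ^ a := Nat.one_le_two_pow
    have h2 : 2 ^ a ≤ 2 ^ a * 2 ^ a := Nat.le_mul_of_pos_left _ h1
    have h3 : m ≤ m.totient ^ 2 := by
      rcases four_mul_le_totient_sq_of_odd m hm with h | rfl | rfl | rfl
      · omega
      all_goals decide
    calc 2 * (2 ^ (a + 3) * m) = 16 * (2 ^ a * m) := by ring
      _ ≤ 16 * (2 ^ a * 2 ^ a * m.totient ^ 2) := by gcongr
      _ = _ := by norm_num; ring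

theorem IsPrimitiveRoot.exists_algEquiv_apply_eq {L : Type*} [Field L] [NumberField L]
    [IsGalois ℚ L] {n : ℕ} [NeZero n] {ζ ξ : L} (hζ : IsPrimitiveRoot ζ n)
    (hξ : IsPrimitiveRoot ξ n) : ∃ σ : L ≃ₐ[ℚ] L, σ ζ = ξ := by
  apply minpoly.exists_algEquiv_of_root' (Algebra.IsAlgebraic.isAlgebraic ζ)
  rw [← Polynomial.cyclotomic_eq_minpoly_rat hζ (NeZero.pos n)]
  simpa [Polynomial.IsRoot.def, Polynomial.aeval_def, Polynomial.eval₂_eq_eval_map] using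
    hξ.isRoot_cyclotomic (NeZero.pos n)

theorem IsPrimitiveRoot.card_filter_apply_eq_mul_totient_le {L : Type*} [Field L] [NumberField L]
    [IsGalois ℚ L] [DecidableEq L] {n : ℕ} [NeZero n] {ζ : L} (hζ : IsPrimitiveRoot ζ n) (η : L) :
    (Finset.univ.filter fun σ : L ≃ₐ[ℚ] L => σ ζ = η).card * n.totient ≤
      Fintype.card (L ≃ₐ[ℚ] L) := by
  rcases (Finset.univ.filter fun σ : L ≃ₐ[ℚ] L => σ ζ = η).eq_empty_or_nonempty with h | ⟨σ₀, h⟩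
  · simp [h]
  have h₀ : σ₀ ζ = η := by simpa using h
  have hex : ∀ p : L, ∃ g : L ≃ₐ[ℚ] L, p ∈ primitiveRoots n L → g ζ = p := by
    intro p
    by_cases hp : p ∈ primitiveRoots n L
    · obtain ⟨g, hg⟩ := hζ.exists_algEquiv_apply_eq (isPrimitiveRoot_of_mem_primitiveRoots hp)
      exact ⟨g, fun _ => hg⟩
    · exact ⟨1, fun h => absurd h hp⟩
  choose g hg using hex
  rw [← hζ.card_primitiveRoots, ← Finset.card_product, ← Finset.card_univ]
  apply Finset.card_le_card_of_injOn (fun x => g x.2 * σ₀⁻¹ * x.1) (fun _ _ => Finset.mem_univ _)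
  have key : ∀ σ : L ≃ₐ[ℚ] L, ∀ p, σ ζ = η → p ∈ primitiveRoots n L →
      (g p * σ₀⁻¹ * σ) ζ = p := by
    intro σ p hσ hp
    have : σ₀⁻¹ η = ζ := by rw [← h₀]; exact σ₀.symm_apply_apply ζ
    rw [AlgEquiv.mul_apply, AlgEquiv.mul_apply, hσ, this, hg p hp]
  rintro ⟨σ, p⟩ hx ⟨τ, q⟩ hy hxy
  simp only [Finset.coe_product, Set.mem_prod, Finset.mem_coe, Finset.mem_filter,
    Finset.mem_univ, true_and] at hx hy hxy
  have hpq : p = q := by rw [← key σ p hx.1 hx.2, ← key τ q hy.1 hy.2, hxy]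
  subst hpq
  rw [mul_left_cancel hxy]

theorem exists_sign_algEquiv_apply {L : Type*} [Field L] [NumberField L] {D : ℚ}
    {w : L} (hw : w ^ 2 = algebraMap ℚ L D) (σ : L ≃ₐ[ℚ] L) :
    ∃ e : ℚ, (e = 1 ∨ e = -1) ∧ σ w = algebraMap ℚ L e * w := by
  have : (σ w) ^ 2 = w ^ 2 := by rw [← map_pow, hw, AlgEquiv.commutes]
  rcases sq_eq_sq_iff_eq_or_eq_neg.1 this with h | h
  · exact ⟨1, Or.inl rfl, by simp [h]⟩
  · exact ⟨-1, Or.inr rfl, by simp [h]⟩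

section TraceMulSqrt

variable {L : Type*} [Field L] [NumberField L] [IsGalois ℚ L]

theorem trace_eq_zero_of_sq_eq_s8 {q : ℚ} (hq : ¬ IsSquare q) {y : L} (hy : y ^ 2 = algebraMap ℚ L q) :
    Algebra.trace ℚ L y = 0 := by
  have h1 : y ∉ Set.range (algebraMap ℚ L) := by
    rintro ⟨r, rfl⟩
    rw [← map_pow] at hy
    exact hq ⟨r, by rw [← (algebraMap ℚ L).injective hy, sq]⟩
  rw [IsGalois.mem_range_algebraMap_iff_fixed] at h1
  push Not at h1
  obtain ⟨σ, hσ⟩ := h1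
  have h2 : σ y = -y := by
    have : (σ y) ^ 2 = y ^ 2 := by rw [← map_pow, hy, AlgEquiv.commutes]
    exact (sq_eq_sq_iff_eq_or_eq_neg.1 this).resolve_left hσ
  have h3 := Algebra.trace_eq_of_algEquiv σ y
  rw [h2, map_neg] at h3
  linarith

theorem trace_mul_pow_sq_eq {D : ℚ} {w : L} (hw : w ^ 2 = algebraMap ℚ L D) {n : ℕ} [NeZero n]
    {ζ : L} (hζ : IsPrimitiveRoot ζ n) {j : ℕ} (hj : j.Coprime n) :
    Algebra.trace ℚ L (w * ζ ^ j) ^ 2 = Algebra.trace ℚ L (w * ζ) ^ 2 := by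
  obtain ⟨σ, hσ⟩ := hζ.exists_algEquiv_apply_eq (hζ.pow_of_coprime j hj)
  obtain ⟨e, he, hew⟩ := exists_sign_algEquiv_apply hw σ
  have h1 := Algebra.trace_eq_of_algEquiv σ (w * ζ)
  rw [map_mul, hσ, hew, mul_assoc, ← Algebra.smul_def, map_smul, smul_eq_mul] at h1
  rw [← h1]
  rcases he with rfl | rfl <;> ring

theorem sum_trace_mul_pow_sq_mul_totient_le {D : ℚ} (hD : 0 ≤ D) {w : L}
    (hw : w ^ 2 = algebraMap ℚ L D) {n : ℕ} [NeZero n] {ζ : L} (hζ : IsPrimitiveRoot ζ n) :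
    (∑ j ∈ Finset.range n, Algebra.trace ℚ L (w * ζ ^ j) ^ 2) * n.totient ≤
      n * D * (Fintype.card (L ≃ₐ[ℚ] L) : ℚ) ^ 2 := by
  classical
  choose e he hew using exists_sign_algEquiv_apply hw
  have hsum : ∀ σ τ : L ≃ₐ[ℚ] L, ∑ j ∈ Finset.range n, (σ ζ * τ ζ) ^ j =
      if τ ζ = (σ ζ)⁻¹ then (n : L) else 0 := by
    intro σ τ
    have hσ0 : σ ζ ≠ 0 := by simpa using hζ.ne_zero (NeZero.ne n)
    split_ifs with h
    · simp [h, hσ0]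
    · have h1 : σ ζ * τ ζ ≠ 1 := fun h' => h (eq_inv_of_mul_eq_one_right h')
      rw [geom_sum_eq h1, mul_pow, ← map_pow, ← map_pow, hζ.pow_eq_one]
      simp
  have hP : (∑ j ∈ Finset.range n, Algebra.trace ℚ L (w * ζ ^ j) ^ 2) =
      ∑ σ : L ≃ₐ[ℚ] L, ∑ τ : L ≃ₐ[ℚ] L,
        e σ * e τ * D * (if τ ζ = (σ ζ)⁻¹ then (n : ℚ) else 0) := by
    apply (algebraMap ℚ L).injective
    simp only [map_sum, map_pow, trace_eq_sum_automorphisms, map_mul, hew]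
    simp_rw [sq, Finset.sum_mul_sum]
    rw [Finset.sum_comm]
    refine Finset.sum_congr rfl fun σ _ => ?_
    rw [Finset.sum_comm]
    refine Finset.sum_congr rfl fun τ _ => ?_
    have : algebraMap ℚ L (if τ ζ = (σ ζ)⁻¹ then (n : ℚ) else 0) =
        if τ ζ = (σ ζ)⁻¹ then (n : L) else 0 := by split_ifs <;> simp
    rw [this, ← hsum, ← hw, Finset.mul_sum]
    refine Finset.sum_congr rfl fun j _ => ?_
    rw [mul_pow]
    ring
  have hle : (∑ j ∈ Finset.range n, Algebra.trace ℚ L (w * ζ ^ j) ^ 2) ≤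
      ∑ σ : L ≃ₐ[ℚ] L, n * D *
        ((Finset.univ.filter fun τ : L ≃ₐ[ℚ] L => τ ζ = (σ ζ)⁻¹).card : ℚ) := by
    rw [hP]
    refine Finset.sum_le_sum fun σ _ => ?_
    rw [Finset.card_filter, Nat.cast_sum, Finset.mul_sum]
    refine Finset.sum_le_sum fun τ _ => ?_
    have hee : e σ * e τ ≤ 1 := by
      rcases he σ with h | h <;> rcases he τ with h' | h' <;> rw [h, h'] <;> norm_num
    have hnD : 0 ≤ (n : ℚ) * D := by positivity
    split_ifs
    · push_cast
      nlinarith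
    · simp
  calc _ ≤ (∑ σ : L ≃ₐ[ℚ] L, n * D *
        ((Finset.univ.filter fun τ : L ≃ₐ[ℚ] L => τ ζ = (σ ζ)⁻¹).card : ℚ)) * n.totient := by
        gcongr
    _ = ∑ σ : L ≃ₐ[ℚ] L, n * D *
        (((Finset.univ.filter fun τ : L ≃ₐ[ℚ] L => τ ζ = (σ ζ)⁻¹).card * n.totient : ℕ) : ℚ) := by
        rw [Finset.sum_mul]
        refine Finset.sum_congr rfl fun σ _ => ?_
        push_cast
        ring
    _ ≤ ∑ σ : L ≃ₐ[ℚ] L, n * D * (Fintype.card (L ≃ₐ[ℚ] L) : ℚ) := by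
        refine Finset.sum_le_sum fun σ _ => ?_
        gcongr
        exact hζ.card_filter_apply_eq_mul_totient_le _
    _ = _ := by
        rw [Finset.sum_const, Finset.card_univ, nsmul_eq_mul]
        ring

theorem totient_sq_mul_trace_sq_le_s8 {D : ℚ} (hD : 0 ≤ D) {w : L}
    (hw : w ^ 2 = algebraMap ℚ L D) {n : ℕ} [NeZero n] {ζ : L} (hζ : IsPrimitiveRoot ζ n) :
    (n.totient : ℚ) ^ 2 * Algebra.trace ℚ L (w * ζ) ^ 2 ≤
      n * D * (Fintype.card (L ≃ₐ[ℚ] L) : ℚ) ^ 2 := by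
  refine le_trans ?_ (sum_trace_mul_pow_sq_mul_totient_le hD hw hζ)
  have h : ∑ j ∈ (Finset.range n).filter (Nat.Coprime n), Algebra.trace ℚ L (w * ζ ^ j) ^ 2 =
      n.totient * Algebra.trace ℚ L (w * ζ) ^ 2 := by
    rw [Nat.totient_eq_card_coprime, ← nsmul_eq_mul]
    refine Finset.sum_eq_card_nsmul fun j hj => trace_mul_pow_sq_eq hw hζ ?_
    exact (Finset.mem_filter.1 hj).2.symm
  rw [sq (n.totient : ℚ), mul_assoc, ← h, mul_comm]
  gcongr
  exact Finset.filter_subset _ _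

theorem trace_mul_eq_zero_of_sq_eq {D q : ℚ} (hq : ¬ IsSquare (q * D)) {w x : L}
    (hw : w ^ 2 = algebraMap ℚ L D) (hx : x ^ 2 = algebraMap ℚ L q) :
    Algebra.trace ℚ L (w * x) = 0 :=
  trace_eq_zero_of_sq_eq_s8 hq (by rw [mul_pow, hw, hx, ← map_mul, mul_comm])

theorem two_mul_trace_mul_sq_le {D : ℚ} (hD : 0 < D) (h1 : ¬ IsSquare D) (h3 : ¬ IsSquare (3 * D))
    {w : L} (hw : w ^ 2 = algebraMap ℚ L D) {n : ℕ} [NeZero n] {ζ : L}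
    (hζ : IsPrimitiveRoot ζ n) :
    2 * Algebra.trace ℚ L (w * ζ) ^ 2 ≤ D * (Fintype.card (L ≃ₐ[ℚ] L) : ℚ) ^ 2 := by
  have main : ∀ (m : ℕ) [NeZero m] (ξ : L), IsPrimitiveRoot ξ m → 2 * m ≤ m.totient ^ 2 →
      2 * Algebra.trace ℚ L (w * ξ) ^ 2 ≤ D * (Fintype.card (L ≃ₐ[ℚ] L) : ℚ) ^ 2 := by
    intro m _ ξ hξ hm
    have h := totient_sq_mul_trace_sq_le_s8 hD.le hw hξ
    have hm' : (2 : ℚ) * m ≤ (m.totient : ℚ) ^ 2 := by exact_mod_cast hm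
    have hm0 : (0 : ℚ) < m := by exact_mod_cast NeZero.pos m
    have h2 := mul_le_mul_of_nonneg_right hm' (sq_nonneg (Algebra.trace ℚ L (w * ξ)))
    refine le_of_mul_le_mul_left ?_ hm0
    linarith
  have hneg : ∀ q : ℚ, q < 0 → ¬ IsSquare (q * D) := by
    rintro q hq ⟨r, hr⟩
    nlinarith [mul_self_nonneg r, mul_neg_of_neg_of_pos hq hD]
  have hsq : ∀ (x : L) (q : ℚ), ¬ IsSquare (q * D) → x ^ 2 = algebraMap ℚ L q →
      Algebra.trace ℚ L (w * x) = 0 := fun x q hq hx => trace_mul_eq_zero_of_sq_eq hq hw hx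
  have hw0 : Algebra.trace ℚ L w = 0 := trace_eq_zero_of_sq_eq_s8 h1 hw
  have zero : Algebra.trace ℚ L (w * ζ) = 0 →
      2 * Algebra.trace ℚ L (w * ζ) ^ 2 ≤ D * (Fintype.card (L ≃ₐ[ℚ] L) : ℚ) ^ 2 := by
    intro h
    rw [h, zero_pow two_ne_zero, mul_zero]
    positivity
  rcases two_mul_le_totient_sq n (NeZero.ne n) with h | rfl | h
  · exact main n ζ hζ h
  · have h5 : IsPrimitiveRoot ((ζ ^ 2) ^ 3) 5 :=
      (hζ.pow (by norm_num) (by norm_num : 10 = 2 * 5)).pow_of_coprime 3 (by norm_num)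
    have h2 : ζ ^ 5 = -1 :=
      (hζ.pow (by norm_num) (by norm_num : 10 = 5 * 2)).eq_neg_one_of_two_right
    have e : (ζ ^ 2) ^ 3 = -ζ := by linear_combination ζ * h2
    have h := main 5 _ h5 (by decide)
    rwa [e, mul_neg, map_neg, neg_sq] at h
  · simp only [Finset.mem_insert, Finset.mem_singleton] at h
    apply zero
    rcases h with rfl | rfl | rfl | rfl | rfl | rfl
    · rw [IsPrimitiveRoot.one_right_iff.1 hζ, mul_one, hw0]
    · rw [hζ.eq_neg_one_of_two_right, mul_neg, mul_one, map_neg, hw0, neg_zero]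
    · have hc := hζ.geom_sum_eq_zero (by norm_num)
      simp only [Finset.sum_range_succ, Finset.sum_range_zero, pow_zero, pow_one] at hc
      have hx := hsq (2 * ζ + 1) (-3) (hneg _ (by norm_num)) (by
        rw [map_neg, map_ofNat]
        linear_combination 4 * hc)
      have e : w * ζ = (1 / 2 : ℚ) • (w * (2 * ζ + 1)) - (1 / 2 : ℚ) • w := by
        simp only [Algebra.smul_def, map_div₀, map_one, map_ofNat]
        ring
      rw [e, map_sub, map_smul, map_smul, hx, hw0, smul_zero, sub_zero]
    · have h2 : ζ ^ 2 = -1 :=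
        (hζ.pow (by norm_num) (by norm_num : 4 = 2 * 2)).eq_neg_one_of_two_right
      exact hsq ζ (-1) (hneg _ (by norm_num)) (by rw [h2, map_neg, map_one])
    · have h2 : ζ ^ 3 = -1 :=
        (hζ.pow (by norm_num) (by norm_num : 6 = 3 * 2)).eq_neg_one_of_two_right
      have hc := (hζ.pow (by norm_num) (by norm_num : 6 = 2 * 3)).geom_sum_eq_zero (by norm_num)
      simp only [Finset.sum_range_succ, Finset.sum_range_zero, pow_zero, pow_one] at hc
      have hx := hsq (2 * ζ - 1) (-3) (hneg _ (by norm_num)) (by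
        rw [map_neg, map_ofNat]
        linear_combination 4 * hc - 4 * ζ * h2)
      have e : w * ζ = (1 / 2 : ℚ) • (w * (2 * ζ - 1)) + (1 / 2 : ℚ) • w := by
        simp only [Algebra.smul_def, map_div₀, map_one, map_ofNat]
        ring
      rw [e, map_add, map_smul, map_smul, hx, hw0, smul_zero, add_zero]
    · have h2 : ζ ^ 6 = -1 :=
        (hζ.pow (by norm_num) (by norm_num : 12 = 6 * 2)).eq_neg_one_of_two_right
      have hc := (hζ.pow (by norm_num) (by norm_num : 12 = 4 * 3)).geom_sum_eq_zero (by norm_num)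
      simp only [Finset.sum_range_succ, Finset.sum_range_zero, pow_zero, pow_one] at hc
      have hx := hsq (2 * ζ - ζ ^ 3) 3 h3 (by
        rw [map_ofNat]
        linear_combination -4 * hc + (1 + 4 * ζ ^ 2) * h2)
      have hy := hsq (ζ ^ 3) (-1) (hneg _ (by norm_num)) (by
        rw [map_neg, map_one]
        linear_combination h2)
      have e : w * ζ = (1 / 2 : ℚ) • (w * (2 * ζ - ζ ^ 3)) + (1 / 2 : ℚ) • (w * ζ ^ 3) := by
        simp only [Algebra.smul_def, map_div₀, map_one, map_ofNat]
        ring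
      rw [e, map_add, map_smul, map_smul, hx, hy, smul_zero, add_zero]

/-- If `u + b√D` is a sum of `N` roots of unity, where neither `D` nor `3D` is a rational square,
then `N ≥ b√(2D)`. -/
theorem mul_sqrt_le_of_sum_eq {D : ℚ} (hD : 0 < D) (h1 : ¬ IsSquare D) (h3 : ¬ IsSquare (3 * D))
    {w : L} (hw : w ^ 2 = algebraMap ℚ L D) {N : ℕ} {x : Fin N → L}
    (hx : ∀ i, IsOfFinOrder (x i)) {u b : ℚ}
    (hxw : ∑ i, x i = algebraMap ℚ L u + algebraMap ℚ L b * w) :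
    (b : ℝ) * Real.sqrt (2 * D) ≤ N := by
  set d := Fintype.card (L ≃ₐ[ℚ] L) with hd
  have hd0 : (0 : ℝ) < d := by exact_mod_cast Fintype.card_pos
  have hDR : (0 : ℝ) < D := by exact_mod_cast hD
  have hdr : Module.finrank ℚ L = d := by
    rw [hd, Fintype.card_eq_nat_card, IsGalois.card_aut_eq_finrank]
  have htr : ∑ i, Algebra.trace ℚ L (w * x i) = b * D * d := by
    rw [← map_sum, ← Finset.mul_sum, hxw]
    have : w * (algebraMap ℚ L u + algebraMap ℚ L b * w) = u • w + algebraMap ℚ L (b * D) := by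
      rw [Algebra.smul_def, map_mul, ← hw]
      ring
    rw [this, map_add, map_smul, trace_eq_zero_of_sq_eq_s8 h1 hw, Algebra.trace_algebraMap, hdr,
      smul_zero, zero_add, nsmul_eq_mul]
    ring
  have hb : ∀ i, 2 * ((Algebra.trace ℚ L (w * x i) : ℚ) : ℝ) ≤ Real.sqrt (2 * D) * d := by
    intro i
    have : NeZero (orderOf (x i)) := ⟨(orderOf_pos_iff.2 (hx i)).ne'⟩
    have h := two_mul_trace_mul_sq_le hD h1 h3 hw (IsPrimitiveRoot.orderOf (x i))
    have h' : 2 * ((Algebra.trace ℚ L (w * x i) : ℚ) : ℝ) ^ 2 ≤ D * (d : ℝ) ^ 2 := by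
      exact_mod_cast h
    refine le_of_abs_le (abs_le_of_sq_le_sq ?_ (by positivity))
    rw [mul_pow, mul_pow, Real.sq_sqrt (by positivity)]
    linarith
  have hfin : 2 * (b * D * d : ℝ) ≤ N * (Real.sqrt (2 * D) * d) := by
    have h := Finset.sum_le_sum fun i (_ : i ∈ Finset.univ) => hb i
    rw [← Finset.mul_sum, ← Rat.cast_sum, htr] at h
    simpa using h
  have hs2 : (0 : ℝ) < Real.sqrt (2 * D) := Real.sqrt_pos.2 (by positivity)
  have hss : Real.sqrt (2 * D) * Real.sqrt (2 * D) = 2 * (D : ℝ) :=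
    Real.mul_self_sqrt (by positivity)
  refine le_of_mul_le_mul_right ?_ (mul_pos hs2 hd0)
  calc _ = b * d * (Real.sqrt (2 * D) * Real.sqrt (2 * D)) := by ring
    _ = 2 * (b * D * d : ℝ) := by rw [hss]; ring
    _ ≤ _ := hfin

end TraceMulSqrt


theorem not_isSquare_four_add_sq {s : ℕ} (hs : 0 < s) : ¬ IsSquare (4 + s ^ 2) := by
  rintro ⟨r, hr⟩
  have h1 : s < r := by nlinarith
  have h2 : r < s + 2 := by nlinarith
  obtain rfl : r = s + 1 := by omega
  have : 2 * s = 3 := by nlinarith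
  omega

theorem not_isSquare_three_mul_four_add_sq (s : ℕ) : ¬ IsSquare (3 * (4 + s ^ 2)) := by
  rintro ⟨r, hr⟩
  have h3 : 3 ∣ r := by
    have : 3 ∣ r * r := ⟨_, hr.symm⟩
    exact (Nat.prime_three.dvd_mul.1 this).elim id id
  obtain ⟨k, rfl⟩ := h3
  have h4 : 4 + s ^ 2 = 3 * (k * k) := by nlinarith
  have h5 : (4 + s ^ 2) % 3 = 0 := by omega
  have h6 : s % 3 < 3 := Nat.mod_lt _ (by norm_num)
  rw [Nat.add_mod, Nat.pow_mod] at h5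
  interval_cases s % 3 <;> simp at h5

/-- For positive integers `s`, `c` and `u ∈ ℚ`: if `u + 2c√(4+s²)` is a sum of `N` roots
of unity, then `N ≥ 2c√(2(4+s²))`. -/
theorem stmt_8 (s c : ℕ) (hs : 0 < s) (hc : 0 < c) (u : ℚ) (N : ℕ) (ζ : Fin N → ℂ)
    (hζ : ∀ i, ∃ k : ℕ, 0 < k ∧ ζ i ^ k = 1)
    (hsum : ∑ i, ζ i =
      ((u : ℝ) : ℂ) + 2 * (c : ℂ) * ((Real.sqrt (4 + (s : ℝ) ^ 2) : ℝ) : ℂ)) :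
    2 * (c : ℝ) * Real.sqrt (2 * (4 + (s : ℝ) ^ 2)) ≤ (N : ℝ) := by
  choose k hk hζk using hζ
  have hM : ∏ i, k i ≠ 0 := Finset.prod_ne_zero_iff.2 fun i _ => (hk i).ne'
  generalize hMk : ∏ i, k i = M at hM
  have hζM : ∀ i, ζ i ^ M = 1 := fun i => by
    obtain ⟨m, hm⟩ := Finset.dvd_prod_of_mem k (Finset.mem_univ i)
    rw [← hMk, hm, pow_mul, hζk, one_pow]
  have : NeZero M := ⟨hM⟩
  let L := CyclotomicField M ℚ
  have : IsCyclotomicExtension {M} ℚ L := CyclotomicField.isCyclotomicExtension M ℚ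
  have : NumberField L := IsCyclotomicExtension.numberField {M} ℚ L
  have : IsGalois ℚ L := IsCyclotomicExtension.isGalois {M} ℚ L
  let ι : L →ₐ[ℚ] ℂ := IsAlgClosed.lift
  have hι : Function.Injective ι := ι.toRingHom.injective
  have hz := (IsCyclotomicExtension.zeta_spec M ℚ L).map_of_injective hι
  have hx : ∀ i, ∃ x : L, ι x = ζ i := fun i => by
    obtain ⟨e, -, he⟩ := hz.eq_pow_of_pow_eq_one (hζM i)
    exact ⟨_, (map_pow ι _ e).trans he⟩
  choose x hx using hx
  have hx1 : ∀ i, IsOfFinOrder (x i) := fun i => isOfFinOrder_iff_pow_eq_one.2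
    ⟨M, NeZero.pos M, hι (by rw [map_pow, hx, hζM, map_one])⟩
  set D : ℚ := ((4 + s ^ 2 : ℕ) : ℚ) with hDdef
  have hD : 0 < D := by rw [hDdef]; positivity
  have hDR : (D : ℝ) = 4 + (s : ℝ) ^ 2 := by rw [hDdef]; push_cast; ring
  have hc0 : (c : ℂ) ≠ 0 := by exact_mod_cast hc.ne'
  obtain ⟨w, hw⟩ : ∃ w : L, ι w = ((Real.sqrt (4 + (s : ℝ) ^ 2) : ℝ) : ℂ) := by
    refine ⟨(∑ i, x i - algebraMap ℚ L u) / (2 * c), ?_⟩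
    rw [map_div₀, map_sub, map_sum, AlgHom.commutes]
    simp only [hx, hsum, map_mul, map_ofNat, map_natCast, eq_ratCast, Complex.ofReal_ratCast]
    field_simp
    ring
  have hwD : w ^ 2 = algebraMap ℚ L D := by
    apply hι
    rw [map_pow, hw, AlgHom.commutes, ← Complex.ofReal_pow, Real.sq_sqrt (by positivity), ← hDR]
    simp
  have hxw : ∑ i, x i = algebraMap ℚ L u + algebraMap ℚ L (2 * c) * w := by
    apply hι
    rw [map_sum, map_add, map_mul, AlgHom.commutes, AlgHom.commutes, hw]
    simp [hx, hsum]
  have h1 : ¬ IsSquare D := by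
    rw [hDdef, Rat.isSquare_natCast_iff]
    exact not_isSquare_four_add_sq hs
  have h3 : ¬ IsSquare (3 * D) := by
    have : 3 * D = ((3 * (4 + s ^ 2) : ℕ) : ℚ) := by rw [hDdef]; push_cast; ring
    rw [this, Rat.isSquare_natCast_iff]
    exact not_isSquare_three_mul_four_add_sq s
  have key := mul_sqrt_le_of_sum_eq hD h1 h3 hwD hx1 hxw
  rw [hDR] at key
  simpa using key
end

section
/- Let m, n be natural numbers, not both zero, set s := m+n and r² := (4+s²)/(4+(m−n)²). If the real number s² + r²(m−n)² + 2s√(4+s²) can be written as a sum of N roots of unity in ℂ with N ≤ 16 + 3s², then s ≤ 4. -/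
open Polynomial

/-- The subring of `ℂ` generated by the roots of unity of order prime to `p`. -/
noncomputable def coprimeCyclotomic (p : ℕ) : Subalgebra ℤ ℂ :=
  Algebra.adjoin ℤ {z | ∃ k, ¬ p ∣ k ∧ z ^ k = 1}

lemma aeval_pow_eq_zero_of_coprime {ε : ℂ} {L c : ℕ} (hL : 0 < L) (hε : IsPrimitiveRoot ε L)
    (hc : c.Coprime L) {F : ℤ[X]} (hF : aeval ε F = 0) : aeval (ε ^ c) F = 0 := by
  have hdvd : minpoly ℤ ε ∣ F := minpoly.isIntegrallyClosed_dvd (hε.isIntegral hL) hF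
  rw [hε.minpoly_eq_pow_coprime hc] at hdvd
  obtain ⟨G, rfl⟩ := hdvd
  simp

lemma exists_aeval_eq_of_mem_coprimeCyclotomic {p : ℕ} (hp : p.Prime) {r : ℂ}
    (hr : r ∈ coprimeCyclotomic p) :
    ∃ M, ¬ p ∣ M ∧ ∀ M', M ∣ M' → 0 < M' → ∀ ε : ℂ, IsPrimitiveRoot ε M' →
      ∃ R : ℤ[X], aeval ε R = r := by
  induction hr using Algebra.adjoin_induction with
  | mem z hz =>
    obtain ⟨k, hk, hz⟩ := hz
    refine ⟨k, hk, fun M' hM' hpos ε hε ↦ ?_⟩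
    have : NeZero M' := ⟨hpos.ne'⟩
    obtain ⟨l, rfl⟩ := hM'
    obtain ⟨i, -, hi⟩ := hε.eq_pow_of_pow_eq_one (ξ := z) (by rw [pow_mul, hz, one_pow])
    exact ⟨X ^ i, by simp [hi]⟩
  | algebraMap a => exact ⟨1, hp.one_lt.ne' ∘ Nat.dvd_one.mp, fun _ _ _ _ _ ↦ ⟨C a, by simp⟩⟩
  | add x y _ _ hx hy =>
    obtain ⟨M₁, h₁, hx⟩ := hx
    obtain ⟨M₂, h₂, hy⟩ := hy
    refine ⟨M₁ * M₂, by simp [hp.dvd_mul, h₁, h₂], fun M' hM' hpos ε hε ↦ ?_⟩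
    obtain ⟨R₁, hR₁⟩ := hx M' (dvd_of_mul_right_dvd hM') hpos ε hε
    obtain ⟨R₂, hR₂⟩ := hy M' (dvd_of_mul_left_dvd hM') hpos ε hε
    exact ⟨R₁ + R₂, by simp [hR₁, hR₂]⟩
  | mul x y _ _ hx hy =>
    obtain ⟨M₁, h₁, hx⟩ := hx
    obtain ⟨M₂, h₂, hy⟩ := hy
    refine ⟨M₁ * M₂, by simp [hp.dvd_mul, h₁, h₂], fun M' hM' hpos ε hε ↦ ?_⟩
    obtain ⟨R₁, hR₁⟩ := hx M' (dvd_of_mul_right_dvd hM') hpos ε hε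
    obtain ⟨R₂, hR₂⟩ := hy M' (dvd_of_mul_left_dvd hM') hpos ε hε
    exact ⟨R₁ * R₂, by simp [hR₁, hR₂]⟩

/-- Conjugating a relation between roots of unity by the inertia group at `p`: each root of unity
splits as `η * ξ` with `η` of `p`-power order, and `η` can be replaced by `η ^ x` for `p ∤ x`. -/
lemma exists_conjugate_relations {p k N : ℕ} (hp : p.Prime) {ζ : Fin N → ℂ}
    (hζ : ∀ i, ∃ k : ℕ, 0 < k ∧ ζ i ^ k = 1) {ω r : ℂ} (hω : ω ^ p ^ k = 1)
    (hr : r ∈ coprimeCyclotomic p) (a : ℤ) (P : ℤ[X]) (hsum : ∑ i, ζ i = a + r * aeval ω P) :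
    ∃ e, k ≤ e ∧ ∃ η ξ : Fin N → ℂ, (∀ i, η i ^ p ^ e = 1) ∧ (∀ i, ‖ξ i‖ = 1) ∧
      ∀ x, ¬ p ∣ x → ∑ i, η i ^ x * ξ i = a + r * aeval (ω ^ x) P := by
  choose ord hord hζ using hζ
  obtain ⟨M₀, hM₀, hR⟩ := exists_aeval_eq_of_mem_coprimeCyclotomic hp hr
  have hM₀pos : 0 < M₀ := Nat.pos_of_ne_zero fun h ↦ hM₀ (h ▸ dvd_zero p)
  have hpk : 0 < p ^ k := pow_pos hp.pos k
  have hKpos : 0 < ∏ i, ord i := Finset.prod_pos fun i _ ↦ hord i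
  obtain ⟨L, hLdef⟩ : ∃ L, L = p ^ k * M₀ * ∏ i, ord i := ⟨_, rfl⟩
  have hLpos : 0 < L := by rw [hLdef]; positivity
  have hordL : ∀ i, ord i ∣ L := fun i ↦
    hLdef ▸ (Finset.dvd_prod_of_mem ord (Finset.mem_univ i)).mul_left _
  obtain ⟨e, M', hM', hLe⟩ := Nat.exists_eq_pow_mul_and_not_dvd hLpos.ne' p hp.one_lt.ne'
  have hM'pos : 0 < M' := Nat.pos_of_ne_zero fun h ↦ hM' (h ▸ dvd_zero p)
  have hcop : Nat.Coprime (p ^ e) M' := ((Nat.Prime.coprime_iff_not_dvd hp).mpr hM').pow_left e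
  have hke : k ≤ e := by
    have h1 : p ^ k ∣ p ^ e * M' := by
      rw [← hLe, hLdef, mul_assoc]; exact dvd_mul_right _ _
    exact (Nat.pow_dvd_pow_iff_le_right hp.one_lt).mp
      ((((Nat.Prime.coprime_iff_not_dvd hp).mpr hM').pow_left k).dvd_of_dvd_mul_right h1)
  have hM₀M' : M₀ ∣ M' := by
    have h1 : M₀ ∣ p ^ e * M' := by
      rw [← hLe, hLdef]; exact Dvd.intro_left (p ^ k) rfl |>.mul_right _
    exact ((((Nat.Prime.coprime_iff_not_dvd hp).mpr hM₀).pow_left e).symm).dvd_of_dvd_mul_left h1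
  have hε := Complex.isPrimitiveRoot_exp L hLpos.ne'
  set ε := Complex.exp (2 * Real.pi * Complex.I / L)
  have : NeZero L := ⟨hLpos.ne'⟩
  have hεM : IsPrimitiveRoot (ε ^ p ^ e) M' := hε.pow hLpos hLe
  obtain ⟨R, hR⟩ := hR M' hM₀M' hM'pos _ hεM
  have hpow : ∀ {z : ℂ} {d : ℕ}, d ∣ L → z ^ d = 1 → ∃ i, ε ^ i = z := fun {z d} hd hz ↦ by
    obtain ⟨i, -, hi⟩ := hε.eq_pow_of_pow_eq_one (ξ := z)
      (by obtain ⟨l, rfl⟩ := hd; rw [pow_mul, hz, one_pow])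
    exact ⟨i, hi⟩
  choose j hj using fun i ↦ hpow (hordL i) (hζ i)
  have hpkL : p ^ k ∣ L := by rw [hLdef, mul_assoc]; exact dvd_mul_right _ _
  obtain ⟨l, hl⟩ := hpow hpkL hω
  obtain ⟨s, hs1, hs0⟩ := Nat.chineseRemainder hcop 1 0
  obtain ⟨t, ht0, ht1⟩ := Nat.chineseRemainder hcop 0 1
  have hs0' : M' ∣ s := (Nat.modEq_zero_iff_dvd).mp hs0
  refine ⟨e, hke, fun i ↦ ζ i ^ s, fun i ↦ ζ i ^ t, fun i ↦ ?_, fun i ↦ ?_, fun x hx ↦ ?_⟩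
  · have hd : ord i ∣ s * p ^ e := (hordL i).trans (by
      rw [hLe, mul_comm]; exact mul_dvd_mul_right hs0' _)
    obtain ⟨u, hu⟩ := hd
    rw [← pow_mul, hu, pow_mul, hζ, one_pow]
  · rw [norm_pow, Complex.norm_eq_one_of_pow_eq_one (hζ i) (hord i).ne', one_pow]
  · have hcx : s * x + t ≡ x [MOD p ^ e] := by simpa using (hs1.mul_right x).add ht0
    have hc1 : s * x + t ≡ 1 [MOD M'] := by simpa using (hs0.mul_right x).add ht1
    have hcL : (s * x + t).Coprime L := by
      rw [hLe]
      refine Nat.Coprime.mul_right ?_ ?_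
      · rw [Nat.Coprime, hcx.gcd_eq]
        exact (((Nat.Prime.coprime_iff_not_dvd hp).mpr hx).pow_left e).symm
      · rw [Nat.Coprime, hc1.gcd_eq, Nat.gcd_one_left]
    have key := aeval_pow_eq_zero_of_coprime hLpos hε hcL
      (F := ∑ i, X ^ j i - C a - R.comp (X ^ p ^ e) * P.comp (X ^ l)) (by
        simp [aeval_comp, hj, hR, hl, hsum])
    have h1 : (ε ^ (s * x + t)) ^ p ^ e = ε ^ p ^ e := by
      rw [← pow_mul, mul_comm, pow_mul]
      conv_rhs => rw [← pow_one (ε ^ p ^ e)]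
      exact pow_eq_pow_of_modEq hc1 hεM.pow_eq_one
    have h2 : (ε ^ (s * x + t)) ^ l = ω ^ x := by
      rw [← pow_mul, mul_comm, pow_mul, hl]
      exact pow_eq_pow_of_modEq (hcx.of_dvd (pow_dvd_pow p hke)) hω
    have h3 : ∀ i, (ε ^ (s * x + t)) ^ j i = (ζ i ^ s) ^ x * ζ i ^ t := fun i ↦ by
      rw [← pow_mul, mul_comm, pow_mul, hj, pow_add, pow_mul]
    simp only [map_sub, map_sum, map_mul, aeval_comp, map_pow, aeval_X, h1, h2, h3, hR,
      aeval_C] at key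
    simp only [algebraMap_int_eq, eq_intCast] at key
    linear_combination key

lemma norm_sum_conjugates_le {p k N : ℕ} (hp : p.Prime) {w : ℕ → ℂ}
    (hw : ∀ y, p ∣ y → w y = 0) {B : ℝ} (hk : 0 < k)
    (hB : ∀ η : ℂ, η ^ p ^ k = 1 → ‖∑ y ∈ Finset.range (p ^ k), w y * η ^ y‖ ≤ B)
    {ζ : Fin N → ℂ} (hζ : ∀ i, ∃ k : ℕ, 0 < k ∧ ζ i ^ k = 1) {ω r : ℂ} (hω : ω ^ p ^ k = 1)
    (hr : r ∈ coprimeCyclotomic p) (a : ℤ) (P : ℤ[X]) (hsum : ∑ i, ζ i = a + r * aeval ω P) :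
    ‖∑ y ∈ Finset.range (p ^ k), w y * (a + r * aeval (ω ^ y) P)‖ ≤ N * B := by
  obtain ⟨e, hke, η, ξ, hη, hξ, hrel⟩ := exists_conjugate_relations hp hζ hω hr a P hsum
  set q := p ^ k with hq
  set Q := p ^ (e - k) with hQ
  have hqQ : q * Q = p ^ e := by rw [hq, hQ, ← pow_add]; congr 1; omega
  have hQpos : 0 < Q := pow_pos hp.pos _
  have hB0 : 0 ≤ B := (norm_nonneg _).trans (hB 1 (one_pow _))
  have hpq : p ∣ q := dvd_pow_self p hk.ne'
  have hlhs : ∑ y ∈ Finset.range q, ∑ z ∈ Finset.range Q,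
      w y * ∑ i, η i ^ (y + q * z) * ξ i
      = Q * ∑ y ∈ Finset.range q, w y * (a + r * aeval (ω ^ y) P) := by
    rw [Finset.mul_sum]
    refine Finset.sum_congr rfl fun y _ ↦ ?_
    by_cases hy : p ∣ y
    · simp [hw y hy]
    · have : ∀ z ∈ Finset.range Q, w y * ∑ i, η i ^ (y + q * z) * ξ i
          = w y * (a + r * aeval (ω ^ y) P) := fun z _ ↦ by
        rw [hrel _ (by rwa [Nat.dvd_add_left (hpq.mul_right z)]), pow_add, pow_mul, hω, one_pow,
          mul_one]
      rw [Finset.sum_congr rfl this]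
      simp
  have hswap : ∑ y ∈ Finset.range q, ∑ z ∈ Finset.range Q,
      w y * ∑ i, η i ^ (y + q * z) * ξ i
      = ∑ i, ξ i * ((∑ y ∈ Finset.range q, w y * η i ^ y) *
          ∑ z ∈ Finset.range Q, (η i ^ q) ^ z) := by
    simp_rw [Finset.sum_mul_sum, Finset.mul_sum]
    rw [Finset.sum_comm (s := Finset.univ)]
    refine Finset.sum_congr rfl fun y _ ↦ ?_
    rw [Finset.sum_comm]
    refine Finset.sum_congr rfl fun i _ ↦ Finset.sum_congr rfl fun z _ ↦ ?_
    rw [pow_add, pow_mul]; ring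
  have hterm : ∀ i, ‖ξ i * ((∑ y ∈ Finset.range q, w y * η i ^ y) *
          ∑ z ∈ Finset.range Q, (η i ^ q) ^ z)‖ ≤ Q * B := fun i ↦ by
    rw [norm_mul, hξ, one_mul, norm_mul]
    by_cases h1 : η i ^ q = 1
    · simp only [h1, one_pow, Finset.sum_const, Finset.card_range, nsmul_eq_mul, mul_one,
        Complex.norm_natCast]
      rw [mul_comm]
      exact mul_le_mul_of_nonneg_left (hB _ h1) (Nat.cast_nonneg _)
    · have : ∑ z ∈ Finset.range Q, (η i ^ q) ^ z = 0 := by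
        rw [geom_sum_eq h1, ← pow_mul, hqQ, hη, sub_self, zero_div]
      rw [this, norm_zero, mul_zero]
      positivity
  have htot : (Q : ℝ) * ‖∑ y ∈ Finset.range q, w y * (a + r * aeval (ω ^ y) P)‖ ≤ Q * (N * B) := by
    calc _ = ‖(Q : ℂ) * ∑ y ∈ Finset.range q, w y * (a + r * aeval (ω ^ y) P)‖ := by simp
      _ ≤ ∑ i : Fin N, (Q * B : ℝ) := by
        rw [← hlhs, hswap]
        exact (norm_sum_le _ _).trans (Finset.sum_le_sum fun i _ ↦ hterm i)
      _ = _ := by simp; ring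
  exact le_of_mul_le_mul_left htot (by exact_mod_cast hQpos)

lemma sum_range_natCast_zmod {n : ℕ} [NeZero n] (F : ZMod n → ℂ) :
    ∑ y ∈ Finset.range n, F y = ∑ x, F x := by
  refine Finset.sum_nbij' (fun y ↦ (y : ZMod n)) ZMod.val (by simp) (fun x _ ↦ ?_)
    (fun y hy ↦ ?_) (by simp) (by simp)
  · simpa using ZMod.val_lt x
  · exact ZMod.val_cast_of_lt (Finset.mem_range.mp hy)

/-- The polynomial whose value at a primitive `ℓ`-th root of unity is the quadratic Gauss sum. -/
noncomputable def gaussPolynomial (ℓ : ℕ) [Fact ℓ.Prime] : ℤ[X] :=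
  ∑ y ∈ Finset.range ℓ, C (quadraticChar (ZMod ℓ) y) * X ^ y

section GaussPolynomial

variable {ℓ : ℕ} [Fact ℓ.Prime]

lemma aeval_gaussPolynomial (η : ℂ) : aeval η (gaussPolynomial ℓ) =
    ∑ y ∈ Finset.range ℓ, (quadraticChar (ZMod ℓ) y : ℂ) * η ^ y := by
  simp [gaussPolynomial]

lemma aeval_gaussPolynomial_eq_gaussSum {η : ℂ} (hη : η ^ ℓ = 1) :
    aeval η (gaussPolynomial ℓ) =
      gaussSum ((quadraticChar (ZMod ℓ)).ringHomComp (Int.castRingHom ℂ))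
        (AddChar.zmodChar ℓ hη) := by
  rw [aeval_gaussPolynomial, gaussSum, ← sum_range_natCast_zmod]
  exact Finset.sum_congr rfl fun y _ ↦ by simp [AddChar.zmodChar_apply']

lemma aeval_gaussPolynomial_pow {η : ℂ} (hη : η ^ ℓ = 1) {y : ℕ} (hy : ¬ ℓ ∣ y) :
    aeval (η ^ y) (gaussPolynomial ℓ) =
      (quadraticChar (ZMod ℓ) y : ℂ) * aeval η (gaussPolynomial ℓ) := by
  have hy0 : (y : ZMod ℓ) ≠ 0 := by rwa [Ne, ZMod.natCast_eq_zero_iff]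
  have hηy : (η ^ y) ^ ℓ = 1 := by rw [← pow_mul, mul_comm, pow_mul, hη, one_pow]
  have hshift : (AddChar.zmodChar ℓ hη).mulShift (y : ZMod ℓ) = AddChar.zmodChar ℓ hηy := by
    ext x
    obtain ⟨x, rfl⟩ := ZMod.natCast_zmod_surjective x
    rw [AddChar.mulShift_apply, ← Nat.cast_mul, AddChar.zmodChar_apply', AddChar.zmodChar_apply',
      pow_mul]
  have hmul := gaussSum_mulShift ((quadraticChar (ZMod ℓ)).ringHomComp (Int.castRingHom ℂ))
    (AddChar.zmodChar ℓ hη) (Units.mk0 _ hy0)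
  rw [Units.val_mk0, hshift] at hmul
  rw [aeval_gaussPolynomial_eq_gaussSum hη, aeval_gaussPolynomial_eq_gaussSum hηy, ← hmul,
    MulChar.ringHomComp_apply, eq_intCast, ← mul_assoc, ← Int.cast_mul, ← sq,
    quadraticChar_sq_one hy0, Int.cast_one, one_mul]

lemma aeval_gaussPolynomial_sq (hℓ : ℓ ≠ 2) {η : ℂ} (hη : IsPrimitiveRoot η ℓ) :
    aeval η (gaussPolynomial ℓ) ^ 2 = (quadraticChar (ZMod ℓ) (-1) : ℂ) * ℓ := by
  have hchar : ringChar (ZMod ℓ) ≠ 2 := by rwa [ZMod.ringChar_zmod_n]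
  rw [aeval_gaussPolynomial_eq_gaussSum hη.pow_eq_one, gaussSum_sq _
    (quadraticChar_isQuadratic (ZMod ℓ) |>.comp _)
    (AddChar.zmodChar_primitive_of_primitive_root ℓ hη), ZMod.card]
  · simp
  · exact (MulChar.ringHomComp_ne_one_iff Int.cast_injective).mpr (quadraticChar_ne_one hchar)

lemma norm_aeval_gaussPolynomial_le (hℓ : ℓ ≠ 2) {η : ℂ} (hη : η ^ ℓ = 1) :
    ‖aeval η (gaussPolynomial ℓ)‖ ≤ √ℓ := by
  have hchar : ringChar (ZMod ℓ) ≠ 2 := by rwa [ZMod.ringChar_zmod_n]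
  by_cases h1 : η = 1
  · have hsum : ∑ y ∈ Finset.range ℓ, ((quadraticChar (ZMod ℓ) y : ℤ) : ℂ) = 0 := by
      rw [sum_range_natCast_zmod (fun x ↦ ((quadraticChar (ZMod ℓ) x : ℤ) : ℂ))]
      exact_mod_cast congrArg (Int.cast (R := ℂ)) (quadraticChar_sum_zero hchar)
    rw [aeval_gaussPolynomial, h1]
    simp only [one_pow, mul_one, hsum, norm_zero, Real.sqrt_nonneg]
  · have hprim : IsPrimitiveRoot η ℓ :=
      IsPrimitiveRoot.iff_orderOf.mpr (orderOf_eq_prime hη h1)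
    refine Real.le_sqrt_of_sq_le ?_
    rw [← norm_pow, aeval_gaussPolynomial_sq hℓ hprim]
    rcases quadraticChar_dichotomy (F := ZMod ℓ) (a := -1) (by simp) with h | h <;> simp [h]

end GaussPolynomial

lemma coprimeCyclotomic.mem_of_pow_eq_one {p k : ℕ} (hk : ¬ p ∣ k) {z : ℂ} (hz : z ^ k = 1) :
    z ∈ coprimeCyclotomic p :=
  Algebra.subset_adjoin ⟨k, hk, hz⟩

lemma add_pow_seven_sq_eq_two {η : ℂ} (hη : η ^ 4 = -1) : (η + η ^ 7) ^ 2 = 2 := by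
  linear_combination (η ^ 10 + 2 * η ^ 4 - η ^ 6 + η ^ 2 - 2) * hη

lemma sqrt_prime_mem_coprimeCyclotomic {p ℓ : ℕ} (hp : p.Prime) (hp2 : p ≠ 2) (hℓ : ℓ.Prime)
    (hpℓ : ¬ p ∣ ℓ) : ((√ℓ : ℝ) : ℂ) ∈ coprimeCyclotomic p := by
  have hsq : (((√ℓ : ℝ) : ℂ)) ^ 2 = ℓ := by
    rw [← Complex.ofReal_pow, Real.sq_sqrt (Nat.cast_nonneg _), Complex.ofReal_natCast]
  have h2 : ¬ p ∣ 2 := fun h ↦ hp2 ((Nat.prime_dvd_prime_iff_eq hp Nat.prime_two).mp h)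
  have hpow2 : ∀ k, ¬ p ∣ 2 ^ k := fun k h ↦ h2 (hp.dvd_of_dvd_pow h)
  have hroot : ∃ g ∈ coprimeCyclotomic p, g ^ 2 = ℓ := by
    rcases eq_or_ne ℓ 2 with rfl | hℓ2
    · have hε := Complex.isPrimitiveRoot_exp 8 (by norm_num)
      set ε := Complex.exp (2 * Real.pi * Complex.I / (8 : ℕ))
      have hε4 : ε ^ 4 = -1 :=
        (hε.pow (by norm_num) (show 8 = 4 * 2 by norm_num)).eq_neg_one_of_two_right
      have hmem := coprimeCyclotomic.mem_of_pow_eq_one (hpow2 3) hε.pow_eq_one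
      exact ⟨ε + ε ^ 7, add_mem hmem (pow_mem hmem 7), by
        exact_mod_cast add_pow_seven_sq_eq_two hε4⟩
    · have : Fact ℓ.Prime := ⟨hℓ⟩
      have hε := Complex.isPrimitiveRoot_exp ℓ hℓ.ne_zero
      set ε := Complex.exp (2 * Real.pi * Complex.I / ℓ)
      have hmem := coprimeCyclotomic.mem_of_pow_eq_one hpℓ hε.pow_eq_one
      have hg : aeval ε (gaussPolynomial ℓ) ∈ coprimeCyclotomic p := by
        rw [aeval_gaussPolynomial]
        exact sum_mem fun y _ ↦ mul_mem (intCast_mem _ _) (pow_mem hmem y)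
      have hsq := aeval_gaussPolynomial_sq hℓ2 hε
      have hI : Complex.I ∈ coprimeCyclotomic p :=
        coprimeCyclotomic.mem_of_pow_eq_one (hpow2 2) Complex.I_pow_four
      rcases quadraticChar_dichotomy (F := ZMod ℓ) (a := -1) (by simp) with h | h
      · exact ⟨_, hg, by simpa [h] using hsq⟩
      · exact ⟨_, mul_mem hI hg, by rw [mul_pow, hsq, h, Complex.I_sq]; push_cast; ring⟩
  obtain ⟨g, hg, hg2⟩ := hroot
  rcases sq_eq_sq_iff_eq_or_eq_neg.mp (hsq.trans hg2.symm) with h | h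
  · exact h ▸ hg
  · exact h ▸ neg_mem hg

lemma sqrt_mem_coprimeCyclotomic {p : ℕ} (hp : p.Prime) (hp2 : p ≠ 2) {q : ℕ}
    (hq : ¬ p ∣ q) : ((√q : ℝ) : ℂ) ∈ coprimeCyclotomic p := by
  induction q using induction_on_primes with
  | zero => simp at hq
  | one => simp [one_mem]
  | prime_mul ℓ a hℓ ih =>
    rw [hp.dvd_mul, not_or] at hq
    rw [Nat.cast_mul, Real.sqrt_mul (Nat.cast_nonneg _), Complex.ofReal_mul]
    exact mul_mem (sqrt_prime_mem_coprimeCyclotomic hp hp2 hℓ hq.1) (ih hq.2)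

lemma le_mul_sqrt_of_sum_eq {p q f m N : ℕ} (hp : p.Prime) (hp4 : p % 4 = 1) (hq : ¬ p ∣ q)
    (hm : f ^ 2 * (p * q) = m ^ 2 + 1) {ζ : Fin N → ℂ} (hζ : ∀ i, ∃ k : ℕ, 0 < k ∧ ζ i ^ k = 1)
    (hsum : ∑ i, ζ i = ((4 * m ^ 2 + 8 * m * √(m ^ 2 + 1) : ℝ) : ℂ)) :
    (p - 1) * (8 * m * √(m ^ 2 + 1)) ≤ N * √p := by
  have : Fact p.Prime := ⟨hp⟩
  have hp2 : p ≠ 2 := by omega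
  have hω := Complex.isPrimitiveRoot_exp p hp.ne_zero
  set ω := Complex.exp (2 * Real.pi * Complex.I / p)
  set g := aeval ω (gaussPolynomial p) with hg
  have hχ : quadraticChar (ZMod p) (-1) = 1 := by
    rw [quadraticChar_one_iff_isSquare (by simp), ZMod.exists_sq_eq_neg_one_iff]
    omega
  have hsq : ((√p : ℝ) : ℂ) ^ 2 = g ^ 2 := by
    rw [← Complex.ofReal_pow, Real.sq_sqrt (Nat.cast_nonneg _), hg,
      aeval_gaussPolynomial_sq hp2 hω, hχ]
    simp
  have hsqrt : √((m : ℝ) ^ 2 + 1) = f * (√p * √q) := by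
    have : (m : ℝ) ^ 2 + 1 = f ^ 2 * (p * q) := by exact_mod_cast hm.symm
    rw [this, Real.sqrt_mul (by positivity), Real.sqrt_sq (by positivity),
      Real.sqrt_mul (by positivity)]
  obtain ⟨r, hr, hrg⟩ : ∃ r ∈ coprimeCyclotomic p,
      r * g = ((8 * m * √(m ^ 2 + 1) : ℝ) : ℂ) := by
    have hmem : (8 * m * f * (√q : ℝ) : ℂ) ∈ coprimeCyclotomic p :=
      mul_mem (by exact_mod_cast natCast_mem (coprimeCyclotomic p) (8 * m * f))
        (sqrt_mem_coprimeCyclotomic hp hp2 hq)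
    rcases sq_eq_sq_iff_eq_or_eq_neg.mp hsq with h | h
    · exact ⟨_, hmem, by rw [hsqrt]; push_cast; rw [h]; ring⟩
    · exact ⟨_, neg_mem hmem, by rw [hsqrt]; push_cast; rw [h]; ring⟩
  have hchar : ringChar (ZMod p) ≠ 2 := by rwa [ZMod.ringChar_zmod_n]
  have hmain := norm_sum_conjugates_le (k := 1) hp
    (w := fun y ↦ ((quadraticChar (ZMod p) y : ℤ) : ℂ))
    (fun y hy ↦ by
      rw [(ZMod.natCast_eq_zero_iff y p).mpr hy, quadraticChar_zero, Int.cast_zero]) one_pos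
    (B := √p) (fun η hη ↦ by
      rw [pow_one] at hη ⊢
      rw [← aeval_gaussPolynomial]
      exact norm_aeval_gaussPolynomial_le hp2 hη)
    hζ (ω := ω) (by rw [pow_one, hω.pow_eq_one]) hr (4 * m ^ 2) (gaussPolynomial p)
    (by rw [hsum, ← hg, hrg]; push_cast; ring)
  have hval : ∑ y ∈ Finset.range (p ^ 1), ((quadraticChar (ZMod p) y : ℤ) : ℂ) *
      (((4 * m ^ 2 : ℤ) : ℂ) + r * aeval (ω ^ y) (gaussPolynomial p)) = (p - 1) * (r * g) := by
    have hterm : ∀ y ∈ Finset.range (p ^ 1), ((quadraticChar (ZMod p) y : ℤ) : ℂ) *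
        (((4 * m ^ 2 : ℤ) : ℂ) + r * aeval (ω ^ y) (gaussPolynomial p)) =
        (fun x : ZMod p ↦ ((quadraticChar (ZMod p) x : ℤ) : ℂ) * ((4 * m ^ 2 : ℤ) : ℂ) +
          if x = 0 then 0 else r * g) y := fun y _ ↦ by
      by_cases hy : (y : ZMod p) = 0
      · simp [hy]
      · have hy' : ¬ p ∣ y := by rwa [← ZMod.natCast_eq_zero_iff]
        have h1 : ((quadraticChar (ZMod p) y : ℤ) : ℂ) ^ 2 = 1 := by
          exact_mod_cast congrArg (Int.cast (R := ℂ)) (quadraticChar_sq_one hy)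
        simp only [hy, if_false]
        rw [aeval_gaussPolynomial_pow hω.pow_eq_one hy']
        linear_combination r * g * h1
    have hrange := sum_range_natCast_zmod (fun x : ZMod p ↦
      ((quadraticChar (ZMod p) x : ℤ) : ℂ) * ((4 * m ^ 2 : ℤ) : ℂ) +
        if x = 0 then 0 else r * g)
    rw [Finset.sum_congr rfl hterm, pow_one, hrange, Finset.sum_add_distrib, ← Finset.sum_mul]
    have h0 : ∑ x : ZMod p, ((quadraticChar (ZMod p) x : ℤ) : ℂ) = 0 := by
      exact_mod_cast congrArg (Int.cast (R := ℂ)) (quadraticChar_sum_zero hchar)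
    rw [h0, zero_mul, zero_add, ← Finset.sum_erase_add _ _ (Finset.mem_univ (0 : ZMod p)),
      if_pos rfl, Finset.sum_congr rfl (fun x hx ↦ if_neg (Finset.ne_of_mem_erase hx)), Finset.sum_const,
      Finset.card_erase_of_mem (Finset.mem_univ _), Finset.card_univ, ZMod.card, nsmul_eq_mul,
      Nat.cast_pred hp.pos, add_zero]
  rw [hval, hrg] at hmain
  have hp1 : (1 : ℝ) ≤ p := by exact_mod_cast hp.one_le
  have hnorm : ‖((p : ℂ) - 1) * ((8 * m * √(m ^ 2 + 1) : ℝ) : ℂ)‖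
      = (p - 1) * (8 * m * √(m ^ 2 + 1)) := by
    rw [norm_mul, Complex.norm_of_nonneg (by positivity)]
    congr 1
    rw [show (p : ℂ) - 1 = ((p - 1 : ℝ) : ℂ) by push_cast; rfl,
      Complex.norm_of_nonneg (by linarith)]
  rwa [hnorm] at hmain

/-- Weights on residues mod `8` for the functional `1 + √2 χ`, with `χ` the character of
`ℚ(√2)`. -/
noncomputable def eightWeight (y : ℕ) : ℂ :=
  if y = 1 ∨ y = 7 then 1 + (√2 : ℝ) else if y = 3 ∨ y = 5 then 1 - (√2 : ℝ) else 0

lemma sum_eightWeight (F : ℕ → ℂ) : ∑ y ∈ Finset.range (2 ^ 3), eightWeight y * F y =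
    (1 + (√2 : ℝ)) * (F 1 + F 7) + (1 - (√2 : ℝ)) * (F 3 + F 5) := by
  norm_num [Finset.sum_range_succ, eightWeight]
  ring

lemma add_pow_seven_eq_sqrt_two_or_neg {η : ℂ} (hη : η ^ 4 = -1) :
    η + η ^ 7 = (√2 : ℝ) ∨ η + η ^ 7 = -(√2 : ℝ) := by
  refine sq_eq_sq_iff_eq_or_eq_neg.mp ?_
  rw [add_pow_seven_sq_eq_two hη, ← Complex.ofReal_pow, Real.sq_sqrt (by norm_num)]
  norm_num

lemma ofReal_sqrt_two_sq : ((√2 : ℝ) : ℂ) ^ 2 = 2 := by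
  rw [← Complex.ofReal_pow, Real.sq_sqrt (by norm_num)]
  norm_num

lemma norm_sum_eightWeight_le {η : ℂ} (hη : η ^ 2 ^ 3 = 1) :
    ‖∑ y ∈ Finset.range (2 ^ 3), eightWeight y * η ^ y‖ ≤ 4 := by
  rw [sum_eightWeight (fun y ↦ η ^ y)]
  have h8 : (η ^ 4 - 1) * (η ^ 4 + 1) = 0 := by linear_combination hη
  have h2 := ofReal_sqrt_two_sq
  rcases mul_eq_zero.mp h8 with h4 | h4
  · have h4' : (η ^ 2 - 1) * (η ^ 2 + 1) = 0 := by linear_combination h4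
    rcases mul_eq_zero.mp h4' with h | h
    · have h1 : ‖η‖ = 1 := Complex.norm_eq_one_of_pow_eq_one hη (by norm_num)
      have : (1 + (√2 : ℝ)) * (η ^ 1 + η ^ 7) + (1 - (√2 : ℝ)) * (η ^ 3 + η ^ 5) = 4 * η := by
        linear_combination (((1 + (√2 : ℝ)) * (η ^ 5 + η ^ 3 + η)) +
          (1 - (√2 : ℝ)) * (η ^ 3 + 2 * η)) * h
      rw [this]
      simp [h1]
    · have : (1 + (√2 : ℝ)) * (η ^ 1 + η ^ 7) + (1 - (√2 : ℝ)) * (η ^ 3 + η ^ 5) = 0 := by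
        linear_combination (((1 + (√2 : ℝ)) * (η ^ 5 - η ^ 3 + η)) +
          (1 - (√2 : ℝ)) * η ^ 3) * h
      rw [this]
      simp
  · have h4' : η ^ 4 = -1 := by linear_combination h4
    have : (1 + (√2 : ℝ)) * (η ^ 1 + η ^ 7) + (1 - (√2 : ℝ)) * (η ^ 3 + η ^ 5)
        = 2 * (√2 : ℝ) * (η + η ^ 7) := by
      linear_combination (1 - (√2 : ℝ)) * (η ^ 3 + η) * h4
    rw [this]
    rcases add_pow_seven_eq_sqrt_two_or_neg h4' with h | h <;> rw [h]
    · rw [show 2 * ((√2 : ℝ) : ℂ) * (√2 : ℝ) = 4 by linear_combination 2 * h2]; simp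
    · rw [show 2 * ((√2 : ℝ) : ℂ) * -(√2 : ℝ) = -4 by linear_combination -2 * h2]; simp

lemma le_of_sum_eq_of_two_mul_sq {f m N : ℕ} (hm : f ^ 2 * 2 = m ^ 2 + 1) {ζ : Fin N → ℂ}
    (hζ : ∀ i, ∃ k : ℕ, 0 < k ∧ ζ i ^ k = 1)
    (hsum : ∑ i, ζ i = ((4 * m ^ 2 + 8 * m * √(m ^ 2 + 1) : ℝ) : ℂ)) :
    4 * m ^ 2 + 16 * m * f ≤ N := by
  have hω := Complex.isPrimitiveRoot_exp 8 (by norm_num)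
  set ω := Complex.exp (2 * Real.pi * Complex.I / (8 : ℕ))
  have hω4 : ω ^ 4 = -1 :=
    (hω.pow (by norm_num) (show 8 = 4 * 2 by norm_num)).eq_neg_one_of_two_right
  have h2 := ofReal_sqrt_two_sq
  have hsqrt : √((m : ℝ) ^ 2 + 1) = f * √2 := by
    have : (m : ℝ) ^ 2 + 1 = f ^ 2 * 2 := by exact_mod_cast hm.symm
    rw [this, Real.sqrt_mul (by positivity), Real.sqrt_sq (by positivity)]
  obtain ⟨r, hr, hrg⟩ : ∃ r ∈ coprimeCyclotomic 2,
      r * (ω + ω ^ 7) = 8 * m * f * (√2 : ℝ) := by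
    have hmem : (8 * m * f : ℂ) ∈ coprimeCyclotomic 2 := by
      exact_mod_cast natCast_mem (coprimeCyclotomic 2) (8 * m * f)
    rcases add_pow_seven_eq_sqrt_two_or_neg hω4 with h | h
    · exact ⟨_, hmem, by rw [h]⟩
    · exact ⟨_, neg_mem hmem, by rw [h]; ring⟩
  have hmain := norm_sum_conjugates_le (k := 3) Nat.prime_two (w := eightWeight)
    (fun y hy ↦ by unfold eightWeight; split_ifs <;> first | rfl | omega) (by norm_num)
    (fun η ↦ norm_sum_eightWeight_le) hζ (ω := ω) (by simpa using hω.pow_eq_one) hr (4 * m ^ 2)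
    (X + X ^ 7) (by
      simp only [map_add, map_pow, aeval_X]
      rw [hsum, hrg, hsqrt]; push_cast; ring)
  have hval : ∑ y ∈ Finset.range (2 ^ 3), eightWeight y *
      (((4 * m ^ 2 : ℤ) : ℂ) + r * aeval (ω ^ y) (X + X ^ 7 : ℤ[X])) =
      ((4 * (4 * m ^ 2 + 16 * m * f) : ℕ) : ℂ) := by
    rw [sum_eightWeight (fun y ↦ ((4 * m ^ 2 : ℤ) : ℂ) + r * aeval (ω ^ y) (X + X ^ 7 : ℤ[X]))]
    simp only [map_add, map_pow, aeval_X]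
    have e1 : ω ^ 1 + (ω ^ 1) ^ 7 = ω + ω ^ 7 := by ring
    have e7 : ω ^ 7 + (ω ^ 7) ^ 7 = ω + ω ^ 7 := by
      rw [← pow_mul, pow_eq_pow_mod (7 * 7) hω.pow_eq_one]; ring
    have e3 : ω ^ 3 + (ω ^ 3) ^ 7 = -(ω + ω ^ 7) := by
      rw [← pow_mul, pow_eq_pow_mod (3 * 7) hω.pow_eq_one]
      norm_num
      linear_combination (ω ^ 3 + ω) * hω4
    have e5 : ω ^ 5 + (ω ^ 5) ^ 7 = -(ω + ω ^ 7) := by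
      rw [← pow_mul, pow_eq_pow_mod (5 * 7) hω.pow_eq_one]
      norm_num
      linear_combination (ω ^ 3 + ω) * hω4
    rw [e1, e3, e5, e7]
    push_cast
    linear_combination 4 * (√2 : ℝ) * hrg + 32 * m * f * h2
  rw [hval, Complex.norm_natCast] at hmain
  have : 4 * (4 * m ^ 2 + 16 * m * f) ≤ N * 4 := by exact_mod_cast hmain
  omega

lemma le_two_of_sum_eq {m N : ℕ} {ζ : Fin N → ℂ} (hζ : ∀ i, ∃ k : ℕ, 0 < k ∧ ζ i ^ k = 1)
    (hsum : ∑ i, ζ i = ((4 * m ^ 2 + 8 * m * √(m ^ 2 + 1) : ℝ) : ℂ))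
    (hN : N ≤ 16 + 12 * m ^ 2) : m ≤ 2 := by
  by_contra! hm3
  obtain ⟨D, f, hD, hsqf⟩ := Nat.sq_mul_squarefree (m ^ 2 + 1)
  by_cases hodd : ∃ p, p.Prime ∧ p ≠ 2 ∧ p ∣ D
  · obtain ⟨p, hp, hp2, q, rfl⟩ := hodd
    have : Fact p.Prime := ⟨hp⟩
    have hpq : ¬ p ∣ q := fun ⟨c, hc⟩ ↦
      hp.one_lt.ne' (Nat.isUnit_iff.mp (hsqf p ⟨c, by rw [hc, mul_assoc]⟩))
    have hp4 : p % 4 = 1 := by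
      have h0 : ((m ^ 2 + 1 : ℕ) : ZMod p) = 0 := by
        rw [ZMod.natCast_eq_zero_iff, ← hD]
        exact (dvd_mul_right p q).mul_left _
      push_cast at h0
      have h3 := ZMod.mod_four_ne_three_of_sq_eq_neg_one (p := p) (y := (m : ZMod p))
        (by linear_combination h0)
      have := hp.eq_two_or_odd
      omega
    have hp5 : 5 ≤ p := by
      have := hp.two_le
      omega
    have hle := le_mul_sqrt_of_sum_eq hp hp4 hpq hD hζ hsum
    have hsq : ((p - 1) * (8 * m * √((m : ℝ) ^ 2 + 1))) ^ 2 ≤ (N * √p) ^ 2 := by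
      have : (1 : ℝ) ≤ p := by exact_mod_cast hp.one_le
      exact pow_le_pow_left₀ (mul_nonneg (by linarith) (by positivity)) hle 2
    rw [mul_pow, mul_pow (8 * (m : ℝ)), mul_pow (N : ℝ), Real.sq_sqrt (by positivity),
      Real.sq_sqrt (by positivity)] at hsq
    have hNr : (N : ℝ) ≤ 16 + 12 * m ^ 2 := by exact_mod_cast hN
    have hp5r : (5 : ℝ) ≤ p := by exact_mod_cast hp5
    have hm3r : (9 : ℝ) ≤ (m : ℝ) ^ 2 := by
      have : (3 : ℝ) ≤ m := by exact_mod_cast hm3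
      nlinarith
    have h1 : (16 / 5 : ℝ) * p ≤ (p - 1) ^ 2 := by nlinarith
    have h2 : (N : ℝ) ^ 2 ≤ (16 + 12 * m ^ 2) ^ 2 := pow_le_pow_left₀ (by positivity) hNr 2
    have h3 : (16 / 5 : ℝ) * p * ((8 * m) ^ 2 * (m ^ 2 + 1)) ≤ (16 + 12 * m ^ 2) ^ 2 * p :=
      (mul_le_mul_of_nonneg_right h1 (by positivity)).trans
        (hsq.trans (mul_le_mul_of_nonneg_right h2 (by positivity)))
    have h4 : (16 / 5 : ℝ) * ((8 * m) ^ 2 * (m ^ 2 + 1)) ≤ (16 + 12 * m ^ 2) ^ 2 :=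
      le_of_mul_le_mul_right (by linarith) (show (0 : ℝ) < p by linarith)
    nlinarith
  · push Not at hodd
    have hD2 : D ∣ 2 := by
      have hpow := Nat.eq_prime_pow_of_unique_prime_dvd hsqf.ne_zero
        (p := 2) (fun {d} hd hdD ↦ by_contra fun h ↦ hodd d hd h hdD)
      have : D.primeFactorsList.length ≤ 1 := by
        by_contra! h
        have h4 : 2 * 2 ∣ D := by
          rw [hpow, ← sq]; exact pow_dvd_pow 2 h
        exact absurd (Nat.isUnit_iff.mp (hsqf 2 h4)) (by norm_num)
      rw [hpow]
      exact (pow_dvd_pow 2 this).trans (by norm_num)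
    rcases (Nat.dvd_prime Nat.prime_two).mp hD2 with rfl | rfl
    · have h1 : m < f := by nlinarith
      nlinarith
    · have hle := (le_of_sum_eq_of_two_mul_sq hD hζ hsum).trans hN
      have h1 : 2 * (m * f) ≤ m ^ 2 + 2 := by nlinarith
      have h2 : (2 * (m * f)) ^ 2 ≤ (m ^ 2 + 2) ^ 2 := Nat.pow_le_pow_left h1 2
      have h3 : (2 * (m * f)) ^ 2 = 2 * m ^ 2 * (m ^ 2 + 1) := by rw [← hD]; ring
      nlinarith


/-- If `s = m + n` (not both `m, n` zero), `r² = (4+s²)/(4+(m−n)²)`, and the real number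
`s² + r²(m−n)² + 2s√(4+s²)` is a sum of `N ≤ 16 + 3s²` roots of unity, then `s ≤ 4`. -/
theorem stmt_9 (m n : ℕ) (h : ¬(m = 0 ∧ n = 0)) (N : ℕ) (ζ : Fin N → ℂ)
    (hζ : ∀ i, ∃ k : ℕ, 0 < k ∧ ζ i ^ k = 1)
    (hsum : ∑ i, ζ i =
      ((((m : ℝ) + n) ^ 2 +
        ((4 + ((m : ℝ) + n) ^ 2) / (4 + ((m : ℝ) - n) ^ 2)) * ((m : ℝ) - n) ^ 2 +
        2 * ((m : ℝ) + n) * Real.sqrt (4 + ((m : ℝ) + n) ^ 2) : ℝ) : ℂ))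
    (hN : N ≤ 16 + 3 * (m + n) ^ 2) :
    m + n ≤ 4 := by
  by_contra! hs
  rcases eq_or_ne m n with rfl | hmn
  · have : m ≤ 2 := by
      refine le_two_of_sum_eq hζ ?_ (hN.trans_eq (by ring))
      rw [hsum]
      have hsqrt : √(4 + ((m : ℝ) + m) ^ 2) = 2 * √((m : ℝ) ^ 2 + 1) := by
        rw [show 4 + ((m : ℝ) + m) ^ 2 = 2 ^ 2 * ((m : ℝ) ^ 2 + 1) by ring,
          Real.sqrt_mul (by positivity), Real.sqrt_sq (by norm_num)]
      rw [hsqrt]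
      congr 1
      ring
    omega
  obtain ⟨s, hs_def⟩ : ∃ s : ℕ, s = m + n := ⟨_, rfl⟩
  obtain ⟨d, hd_def⟩ : ∃ d : ℕ, d = ((m : ℤ) - n).natAbs := ⟨_, rfl⟩
  have hsr : (m : ℝ) + n = s := by rw [hs_def]; push_cast; rfl
  have hdr : ((m : ℝ) - n) ^ 2 = (d : ℝ) ^ 2 := by
    have : ((m : ℤ) - n) ^ 2 = (d : ℤ) ^ 2 := by rw [hd_def, Int.natAbs_sq]
    exact_mod_cast this
  have hd1 : 1 ≤ d := by omega
  have hpar : s % 2 = d % 2 := by omega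
  rw [← hs_def] at hs hN
  rw [hsr, hdr] at hsum
  set u : ℝ := (4 + (s : ℝ) ^ 2) / (4 + (d : ℝ) ^ 2) * (d : ℝ) ^ 2 with hu
  have hsr5 : (5 : ℝ) ≤ s := by exact_mod_cast hs
  have hbound : (s : ℝ) ^ 2 + u + 2 * s * √(4 + (s : ℝ) ^ 2) ≤ N := by
    have h1 : ‖∑ i, ζ i‖ ≤ ∑ _i : Fin N, (1 : ℝ) :=
      (norm_sum_le _ _).trans (Finset.sum_le_sum fun i _ ↦ by
        obtain ⟨k, hk, hz⟩ := hζ i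
        exact (Complex.norm_eq_one_of_pow_eq_one hz hk.ne').le)
    rw [hsum, Complex.norm_of_nonneg (by positivity)] at h1
    simpa using h1
  have hNr : (N : ℝ) ≤ 16 + 3 * s ^ 2 := by exact_mod_cast hN
  have hroot : 2 * (s : ℝ) ^ 2 + 3 ≤ 2 * s * √(4 + (s : ℝ) ^ 2) := by
    have : ((2 * (s : ℝ) ^ 2 + 3) / (2 * s)) ≤ √(4 + (s : ℝ) ^ 2) := by
      refine Real.le_sqrt_of_sq_le ?_
      rw [div_pow, div_le_iff₀ (by positivity)]
      nlinarith
    rw [div_le_iff₀ (by positivity)] at this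
    linarith
  have hu13 : u ≤ 13 := by linarith
  have hud : (4 + (s : ℝ) ^ 2) * d ^ 2 ≤ 13 * (4 + (d : ℝ) ^ 2) := by
    rw [hu, div_mul_eq_mul_div, div_le_iff₀ (by positivity)] at hu13
    exact hu13
  have hudN : (4 + s ^ 2) * d ^ 2 ≤ 13 * (4 + d ^ 2) := by exact_mod_cast hud
  have hd : d = 1 := by
    by_contra hne
    have h2 : 2 ≤ d := by omega
    have : 4 ≤ d ^ 2 := by nlinarith
    have : 25 ≤ s ^ 2 := by nlinarith
    nlinarith
  subst hd
  have hs8 : s < 8 := by nlinarith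
  have huint : IsIntegral ℤ ((u : ℝ) : ℂ) := by
    have h1 : IsIntegral ℤ (∑ i, ζ i) := IsIntegral.sum _ fun i _ ↦ by
      obtain ⟨k, hk, hz⟩ := hζ i
      exact IsIntegral.of_pow hk (hz ▸ isIntegral_one)
    have hrt : IsIntegral ℤ ((√(4 + (s : ℝ) ^ 2) : ℝ) : ℂ) := by
      refine IsIntegral.of_pow two_pos ?_
      rw [← Complex.ofReal_pow, Real.sq_sqrt (by positivity)]
      exact_mod_cast isIntegral_natCast (R := ℤ) (B := ℂ) (4 + s ^ 2)
    have h2 : ((u : ℝ) : ℂ) = ∑ i, ζ i - ((s ^ 2 : ℕ) : ℂ) -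
        ((2 * s : ℕ) : ℂ) * ((√(4 + (s : ℝ) ^ 2) : ℝ) : ℂ) := by
      rw [hsum]; push_cast; ring
    rw [h2]
    exact (h1.sub (isIntegral_natCast _)).sub ((isIntegral_natCast _).mul hrt)
  have huq : ((u : ℝ) : ℂ) = algebraMap ℚ ℂ ((4 + (s : ℚ) ^ 2) / 5) := by
    rw [hu]; push_cast; norm_num
  rw [huq, isIntegral_algebraMap_iff (algebraMap ℚ ℂ).injective] at huint
  obtain ⟨z, hz⟩ := IsIntegrallyClosed.isIntegral_iff.mp huint
  have hz5 : 5 * z = 4 + (s : ℤ) ^ 2 := by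
    have : (5 : ℚ) * z = 4 + (s : ℚ) ^ 2 := by
      rw [algebraMap_int_eq, eq_intCast] at hz
      rw [hz]; ring
    exact_mod_cast this
  interval_cases s <;> omega
end

section
/- Let s be a natural number, q a rational number, and c an integer with c ≥ 1 and c ≥ s−2. If q + 2c√(4+s²) can be written as a sum of N roots of unity in ℂ with N ≤ 8 + (3/2)s², then s ≤ 5. -/
open Polynomial in
/-- A rational linear relation between `n`-th roots of unity is preserved by raising each of them
to a power prime to `n`. -/
theorem sum_mul_pow_eq_zero_of_coprime {ι : Type*} [Fintype ι] {n b : ℕ} (hn : n ≠ 0)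
    (hb : b.Coprime n) (w : ι → ℚ) (x : ι → ℂ) (hx : ∀ i, x i ^ n = 1)
    (h : ∑ i, (w i : ℂ) * x i = 0) : ∑ i, (w i : ℂ) * x i ^ b = 0 := by
  have : NeZero n := ⟨hn⟩
  have hμ := Complex.isPrimitiveRoot_exp n hn
  set μ := Complex.exp (2 * Real.pi * Complex.I / n)
  choose e _ he using fun i => hμ.eq_pow_of_pow_eq_one (hx i)
  let P : ℚ[X] := ∑ i, C (w i) * X ^ e i
  have hP (u : ℂ) : aeval u P = ∑ i, (w i : ℂ) * u ^ e i := by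
    simp [P, map_sum]
  have h0 : aeval μ P = 0 := by
    rw [hP, ← h]
    simp only [he]
  have hdvd := minpoly.dvd ℚ μ h0
  have hpos := Nat.pos_of_ne_zero hn
  rw [← cyclotomic_eq_minpoly_rat hμ hpos,
    cyclotomic_eq_minpoly_rat (hμ.pow_of_coprime b hb) hpos] at hdvd
  have h1 : aeval (μ ^ b) P = 0 := by
    obtain ⟨Q, hQ⟩ := hdvd
    rw [hQ, map_mul, minpoly.aeval, zero_mul]
  rw [hP] at h1
  rw [← h1]
  refine Finset.sum_congr rfl fun i _ => ?_
  rw [← he i, ← pow_mul, ← pow_mul, mul_comm (e i)]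

/-- The quadratic Gauss sum modulo `p`, evaluated at an arbitrary complex number. -/
noncomputable def quadraticGaussSum (p : ℕ) [Fact p.Prime] (u : ℂ) : ℂ :=
  ∑ j : ZMod p, (quadraticChar (ZMod p) j : ℂ) * u ^ j.val

section GaussSum

variable {p : ℕ} [Fact p.Prime]

theorem sum_quadraticChar_zmod (hp : p % 4 = 1) : ∑ j : ZMod p, quadraticChar (ZMod p) j = 0 := by
  apply quadraticChar_sum_zero
  rw [ZMod.ringChar_zmod_n]
  omega

theorem quadraticGaussSum_eq_gaussSum {u : ℂ} (hu : u ^ p = 1) :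
    quadraticGaussSum p u = gaussSum ((quadraticChar (ZMod p)).ringHomComp (Int.castRingHom ℂ))
      (AddChar.zmodChar p hu) := by
  simp [quadraticGaussSum, gaussSum, AddChar.zmodChar_apply]

theorem quadraticGaussSum_sq (hp : p % 4 = 1) {u : ℂ} (hu : IsPrimitiveRoot u p) :
    quadraticGaussSum p u ^ 2 = p := by
  have hF : ringChar (ZMod p) ≠ 2 := by
    rw [ZMod.ringChar_zmod_n]
    omega
  have hχ : (quadraticChar (ZMod p)).ringHomComp (Int.castRingHom ℂ) ≠ 1 := by
    rw [MulChar.ringHomComp_ne_one_iff (RingHom.injective_int _)]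
    exact quadraticChar_ne_one hF
  rw [quadraticGaussSum_eq_gaussSum hu.pow_eq_one,
    gaussSum_sq hχ ((quadraticChar_isQuadratic _).comp _)
      (AddChar.zmodChar_primitive_of_primitive_root p hu)]
  have h1 : quadraticChar (ZMod p) (-1) = 1 := by
    rw [quadraticChar_one_iff_isSquare (by simp), ZMod.exists_sq_eq_neg_one_iff]
    omega
  simp [MulChar.ringHomComp_apply, h1]

theorem norm_quadraticGaussSum_le (hp : p % 4 = 1) {u : ℂ} (hu : u ^ p = 1) :
    ‖quadraticGaussSum p u‖ ≤ √p := by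
  by_cases h1 : u = 1
  · have : quadraticGaussSum p u = ((∑ j : ZMod p, quadraticChar (ZMod p) j : ℤ) : ℂ) := by
      simp [quadraticGaussSum, h1]
    rw [this, sum_quadraticChar_zmod hp]
    simp
  · have hu' : IsPrimitiveRoot u p := orderOf_eq_prime hu h1 ▸ IsPrimitiveRoot.orderOf u
    have h := congrArg norm (quadraticGaussSum_sq hp hu')
    rw [norm_pow, Complex.norm_natCast] at h
    rw [← h, Real.sqrt_sq (norm_nonneg _)]

theorem quadraticGaussSum_pow {u : ℂ} (hu : u ^ p = 1) {c : ℕ} (hc : (c : ZMod p) ≠ 0) :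
    quadraticGaussSum p (u ^ c) =
      (quadraticChar (ZMod p) c : ℂ) * quadraticGaussSum p u := by
  have huc : (u ^ c) ^ p = 1 := by rw [← pow_mul, mul_comm, pow_mul, hu, one_pow]
  have hshift : AddChar.zmodChar p huc = (AddChar.zmodChar p hu).mulShift (c : ZMod p) := by
    ext j
    rw [AddChar.mulShift_apply, AddChar.zmodChar_apply, ← pow_mul]
    have : (c : ZMod p) * j = ((c * j.val : ℕ) : ZMod p) := by simp
    rw [this, AddChar.zmodChar_apply']
  have h := gaussSum_mulShift ((quadraticChar (ZMod p)).ringHomComp (Int.castRingHom ℂ))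
    (AddChar.zmodChar p hu) (Units.mk0 _ hc)
  rw [Units.val_mk0, ← hshift, ← quadraticGaussSum_eq_gaussSum,
    ← quadraticGaussSum_eq_gaussSum] at h
  rw [← h, ← mul_assoc, MulChar.ringHomComp_apply, eq_intCast, ← Int.cast_mul, ← sq,
    quadraticChar_sq_one hc, Int.cast_one, one_mul]

/-- The sum of `χ(c) u ^ c` over the residues `c = j + p t` modulo `p ^ (K + 1)`, where `χ` is the
quadratic character modulo `p`. -/
theorem norm_sum_quadraticChar_mul_pow_le (hp : p % 4 = 1) {u : ℂ} {K : ℕ}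
    (hu : u ^ p ^ (K + 1) = 1) :
    ‖∑ t ∈ Finset.range (p ^ K), ∑ j : ZMod p,
      (quadraticChar (ZMod p) j : ℂ) * u ^ (j.val + p * t)‖ ≤ p ^ K * √p := by
  have hfac : ∑ t ∈ Finset.range (p ^ K), ∑ j : ZMod p,
      (quadraticChar (ZMod p) j : ℂ) * u ^ (j.val + p * t) =
      (∑ t ∈ Finset.range (p ^ K), (u ^ p) ^ t) * quadraticGaussSum p u := by
    rw [quadraticGaussSum, Finset.sum_mul_sum]
    refine Finset.sum_congr rfl fun t _ => Finset.sum_congr rfl fun j _ => ?_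
    ring
  rw [hfac, norm_mul]
  by_cases h1 : u ^ p = 1
  · rw [h1]
    simpa using mul_le_mul_of_nonneg_left (norm_quadraticGaussSum_le hp h1) (by positivity)
  · have : ∑ t ∈ Finset.range (p ^ K), (u ^ p) ^ t = 0 := by
      rw [geom_sum_eq h1, ← pow_mul, ← pow_succ', hu]
      simp
    rw [this]
    simp
    positivity

end GaussSum

/-- If `q + R g` is a sum of `N` roots of unity, where `g` is a quadratic Gauss sum modulo `p` and
`R` is a rational combination of roots of unity of order prime to `p`, then `|R| (p - 1) ≤ N`. -/
theorem norm_mul_le_card_of_sum_eq_add_mul_quadraticGaussSum {p : ℕ} [Fact p.Prime]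
    (hp : p % 4 = 1) {ι κ : Type*} [Fintype ι] [Fintype κ] {M : ℕ} (hM : ¬ p ∣ M)
    (w : κ → ℚ) (y : κ → ℂ) (hy : ∀ l, y l ^ M = 1) (q : ℚ) {z : ℂ} (hz : IsPrimitiveRoot z p)
    (ζ : ι → ℂ) (hζ : ∀ i, ∃ k : ℕ, 0 < k ∧ ζ i ^ k = 1)
    (h : ∑ i, ζ i = q + (∑ l, (w l : ℂ) * y l) * quadraticGaussSum p z) :
    ‖∑ l, (w l : ℂ) * y l‖ * (p - 1) ≤ Fintype.card ι := by
  have hpp : p.Prime := Fact.out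
  choose k hk0 hk using hζ
  have hM0 : M ≠ 0 := by
    rintro rfl
    exact hM (dvd_zero p)
  have hn0 : M * ∏ i, k i ≠ 0 := mul_ne_zero hM0 (Finset.prod_ne_zero_iff.2 fun i _ => (hk0 i).ne')
  obtain ⟨K, m, hpm, hKm⟩ := Nat.exists_eq_pow_mul_and_not_dvd hn0 p hpp.ne_one
  have hcop : (p ^ (K + 1)).Coprime m := ((Nat.Prime.coprime_iff_not_dvd hpp).2 hpm).pow_left _
  have hMm : M ∣ m := by
    have h1 : M ∣ p ^ K * m := hKm ▸ Dvd.intro _ rfl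
    exact (((Nat.Prime.coprime_iff_not_dvd hpp).2 hM).symm.pow_right K).dvd_of_dvd_mul_left h1
  have hm0 : m ≠ 0 := by
    rintro rfl
    exact hpm (dvd_zero p)
  set n := p ^ (K + 1) * m with hn
  have hnne : n ≠ 0 := mul_ne_zero (pow_ne_zero _ hpp.ne_zero) hm0
  have pow_one_of_dvd {x : ℂ} {a b : ℕ} (hx : x ^ a = 1) (hab : a ∣ b) : x ^ b = 1 := by
    obtain ⟨d, rfl⟩ := hab
    rw [pow_mul, hx, one_pow]
  have hζn (i : ι) : ζ i ^ n = 1 := by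
    refine pow_one_of_dvd (hk i) ?_
    have h1 : k i ∣ M * ∏ i, k i := Dvd.dvd.mul_left (Finset.dvd_prod_of_mem k (Finset.mem_univ i)) M
    rw [hKm] at h1
    exact h1.trans (mul_dvd_mul_right (pow_dvd_pow p K.le_succ) m)
  have hym (l : κ) : y l ^ m = 1 := pow_one_of_dvd (hy l) hMm
  have hpK : p ∣ p ^ (K + 1) := dvd_pow_self p K.succ_ne_zero
  obtain ⟨A, hA1, hA0⟩ := Nat.chineseRemainder hcop 1 0
  obtain ⟨B, hB0, hB1⟩ := Nat.chineseRemainder hcop 0 1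
  rw [Nat.modEq_zero_iff_dvd] at hA0 hB0
  have hyB (l : κ) : y l ^ B = y l := by
    conv_rhs => rw [← pow_one (y l)]
    exact pow_eq_pow_of_modEq hB1 (hym l)
  have hzA : z ^ A = z := by
    conv_rhs => rw [← pow_one z]
    exact pow_eq_pow_of_modEq (hA1.of_dvd hpK) hz.pow_eq_one
  have hzB : z ^ B = 1 := pow_one_of_dvd hz.pow_eq_one (hpK.trans hB0)
  have hyA (l : κ) : y l ^ A = 1 := pow_one_of_dvd (hym l) hA0
  set R := ∑ l, (w l : ℂ) * y l with hR
  set g := quadraticGaussSum p z with hg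
  -- the relation after applying the automorphism attached to `c`
  have hconj (c : ℕ) (hc : (c : ZMod p) ≠ 0) :
      ∑ i, ζ i ^ B * (ζ i ^ A) ^ c = q + R * ((quadraticChar (ZMod p) c : ℂ) * g) := by
    have hcp : ¬ p ∣ c := fun hd => hc ((ZMod.natCast_eq_zero_iff _ _).2 hd)
    have hb : (A * c + B).Coprime n := by
      rw [hn, Nat.coprime_mul_iff_right]
      constructor
      · have h1 : A * c + B ≡ 1 * c + 0 [MOD p ^ (K + 1)] :=
          (hA1.mul_right c).add ((Nat.modEq_zero_iff_dvd).2 hB0)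
        rw [Nat.Coprime, h1.gcd_eq]
        simpa using (((Nat.Prime.coprime_iff_not_dvd hpp).2 hcp).symm.pow_right (K + 1))
      · have h1 : A * c + B ≡ 0 * c + 1 [MOD m] :=
          (((Nat.modEq_zero_iff_dvd).2 hA0).mul_right c).add hB1
        rw [Nat.Coprime, h1.gcd_eq]
        simp
    have key := sum_mul_pow_eq_zero_of_coprime (ι := ι ⊕ Unit ⊕ (κ × ZMod p)) hnne hb
      (Sum.elim (fun _ => 1) (Sum.elim (fun _ => -q)
        fun lj => -(w lj.1 * (quadraticChar (ZMod p) lj.2 : ℚ))))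
      (Sum.elim ζ (Sum.elim (fun _ => 1) fun lj => y lj.1 * z ^ lj.2.val))
      (by
        rintro (i | _ | lj)
        · exact hζn i
        · simp
        · simp only [Sum.elim_inr]
          rw [mul_pow, ← pow_mul z, mul_comm lj.2.val, pow_mul z,
            pow_one_of_dvd (hym lj.1) (Dvd.intro_left _ rfl),
            pow_one_of_dvd hz.pow_eq_one (hpK.trans (Dvd.intro _ rfl))]
          simp)
      (by
        simp only [Fintype.sum_sum_type, Sum.elim_inl, Sum.elim_inr, Rat.cast_one, one_mul, h, hR,
          hg, quadraticGaussSum, Finset.sum_mul_sum, Fintype.sum_prod_type]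
        simp only [Finset.univ_unique, Finset.sum_const, Finset.card_singleton, one_smul,
          Rat.cast_neg, Rat.cast_mul, Rat.cast_intCast, neg_mul, Finset.sum_neg_distrib, mul_one]
        have : ∀ l j, (w l : ℂ) * (quadraticChar (ZMod p) j : ℂ) * (y l * z ^ j.val) =
          (w l : ℂ) * y l * ((quadraticChar (ZMod p) j : ℂ) * z ^ j.val) := fun l j => by ring
        simp only [this]
        ring)
    have hgc := quadraticGaussSum_pow hz.pow_eq_one hc
    have hyb (l : κ) : y l ^ (A * c + B) = y l := by
      rw [pow_add, pow_mul, hyA, one_pow, one_mul, hyB]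
    have hzb : z ^ (A * c + B) = z ^ c := by
      rw [pow_add, pow_mul, hzA, hzB, mul_one]
    have hζb (i : ι) : ζ i ^ (A * c + B) = ζ i ^ B * (ζ i ^ A) ^ c := by
      rw [pow_add, pow_mul, mul_comm]
    simp only [Fintype.sum_sum_type, Sum.elim_inl, Sum.elim_inr, Rat.cast_one, one_mul,
      Fintype.sum_prod_type, Finset.univ_unique, Finset.sum_const, Finset.card_singleton, one_smul,
      Rat.cast_neg, Rat.cast_mul, Rat.cast_intCast, neg_mul, Finset.sum_neg_distrib, one_pow,
      mul_one, mul_pow, hyb, hζb] at key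
    have h2 : ∀ l (j : ZMod p), (w l : ℂ) * (quadraticChar (ZMod p) j : ℂ) *
        (y l * (z ^ j.val) ^ (A * c + B)) =
        (w l : ℂ) * y l * ((quadraticChar (ZMod p) j : ℂ) * (z ^ c) ^ j.val) := fun l j => by
      rw [← pow_mul, mul_comm j.val, pow_mul, hzb]
      ring
    simp only [h2] at key
    rw [← hgc, hR, quadraticGaussSum, Finset.sum_mul_sum]
    linear_combination key
  -- average against the quadratic character
  have hsum : ∑ i, ζ i ^ B * ∑ t ∈ Finset.range (p ^ K), ∑ j : ZMod p,
      (quadraticChar (ZMod p) j : ℂ) * (ζ i ^ A) ^ (j.val + p * t) =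
      (p : ℂ) ^ K * (R * g * ((p : ℂ) - 1)) := by
    have h1 : ∑ i, ζ i ^ B * ∑ t ∈ Finset.range (p ^ K), ∑ j : ZMod p,
        (quadraticChar (ZMod p) j : ℂ) * (ζ i ^ A) ^ (j.val + p * t) =
        ∑ t ∈ Finset.range (p ^ K), ∑ j : ZMod p, (quadraticChar (ZMod p) j : ℂ) *
          ∑ i, ζ i ^ B * (ζ i ^ A) ^ (j.val + p * t) := by
      simp only [Finset.mul_sum]
      rw [Finset.sum_comm]
      refine Finset.sum_congr rfl fun t _ => ?_
      rw [Finset.sum_comm]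
      refine Finset.sum_congr rfl fun j _ => Finset.sum_congr rfl fun i _ => ?_
      ring
    have h2 (t : ℕ) (j : ZMod p) : (quadraticChar (ZMod p) j : ℂ) *
        ∑ i, ζ i ^ B * (ζ i ^ A) ^ (j.val + p * t) =
        q * (quadraticChar (ZMod p) j : ℂ) + R * g * (if j = 0 then 0 else 1) := by
      by_cases hj : j = 0
      · simp [hj]
      · have hcast : ((j.val + p * t : ℕ) : ZMod p) = j := by simp
        have hsq : (quadraticChar (ZMod p) j : ℂ) ^ 2 = 1 := by
          exact_mod_cast quadraticChar_sq_one hj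
        rw [hconj _ (hcast.symm ▸ hj), hcast, if_neg hj]
        linear_combination R * g * hsq
    have h3 : ∑ j : ZMod p, (quadraticChar (ZMod p) j : ℂ) = 0 := by
      exact_mod_cast sum_quadraticChar_zmod hp
    have h4 : ∑ j : ZMod p, (if j = 0 then (0 : ℂ) else 1) = p - 1 := by
      have : ∀ j : ZMod p, (if j = 0 then (0 : ℂ) else 1) = 1 - if j = 0 then 1 else 0 := by
        intro j
        split_ifs <;> simp
      simp [this, ZMod.card]
    rw [h1]
    simp only [h2, Finset.sum_add_distrib, ← Finset.mul_sum, h3, h4, Finset.sum_const,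
      Finset.card_range]
    simp
    ring
  have hpp0 : (0 : ℝ) < p := by exact_mod_cast hpp.pos
  have hp1 : (1 : ℝ) ≤ p := by exact_mod_cast hpp.one_le
  have hgn : ‖g‖ = √p := by
    have h1 := congrArg norm (quadraticGaussSum_sq hp hz)
    rw [norm_pow, Complex.norm_natCast] at h1
    rw [← h1, Real.sqrt_sq (norm_nonneg _)]
  have hbound : ‖(p : ℂ) ^ K * (R * g * ((p : ℂ) - 1))‖ ≤ Fintype.card ι * (p ^ K * √p) := by
    rw [← hsum]
    refine (norm_sum_le _ _).trans ?_
    rw [← nsmul_eq_mul]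
    refine Finset.sum_le_card_nsmul _ _ _ fun i _ => ?_
    rw [norm_mul, norm_pow, Complex.norm_eq_one_of_pow_eq_one (hζn i) hnne, one_pow, one_mul]
    apply norm_sum_quadraticChar_mul_pow_le hp
    rw [← pow_mul]
    refine pow_one_of_dvd (hζn i) ?_
    rw [hn, mul_comm A]
    exact mul_dvd_mul_left _ hA0
  have hnp : ‖(p : ℂ) - 1‖ = p - 1 := by
    have : ((p : ℂ) - 1) = ((p - 1 : ℝ) : ℂ) := by push_cast; rfl
    rw [this, Complex.norm_real, Real.norm_of_nonneg (by linarith)]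
  rw [norm_mul, norm_mul, norm_mul, norm_pow, Complex.norm_natCast, hgn, hnp] at hbound
  have hpos : 0 < (p : ℝ) ^ K * √p := by positivity
  refine le_of_mul_le_mul_right ?_ hpos
  linarith

/-- If `q + t √(e p)` is a sum of `N` roots of unity, where `√e` is a rational combination of roots
of unity of order prime to `p`, then `|t| √e (p - 1) ≤ N`. -/
theorem abs_mul_sqrt_mul_le_card {p : ℕ} [Fact p.Prime]
    (hp : p % 4 = 1) {ι κ : Type*} [Fintype ι] [Fintype κ] {M : ℕ} (hM : ¬ p ∣ M)
    (w : κ → ℚ) (y : κ → ℂ) (hy : ∀ l, y l ^ M = 1) {e : ℕ}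
    (he : (∑ l, (w l : ℂ) * y l) ^ 2 = e) (q t : ℚ)
    (ζ : ι → ℂ) (hζ : ∀ i, ∃ k : ℕ, 0 < k ∧ ζ i ^ k = 1)
    (h : ∑ i, ζ i = q + t * (√((e : ℝ) * p) : ℝ)) :
    |(t : ℝ)| * √e * (p - 1) ≤ Fintype.card ι := by
  have hz := Complex.isPrimitiveRoot_exp p (NeZero.ne p)
  set z := Complex.exp (2 * Real.pi * Complex.I / p)
  have hnorm : ‖∑ l, (w l : ℂ) * y l‖ = √e := by
    have h1 := congrArg norm he
    rw [norm_pow, Complex.norm_natCast] at h1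
    rw [← h1, Real.sqrt_sq (norm_nonneg _)]
  have hsq : ((√((e : ℝ) * p) : ℝ) : ℂ) ^ 2 =
      ((∑ l, (w l : ℂ) * y l) * quadraticGaussSum p z) ^ 2 := by
    rw [mul_pow, he, quadraticGaussSum_sq hp hz, ← Complex.ofReal_pow,
      Real.sq_sqrt (by positivity)]
    push_cast
    rfl
  obtain ⟨ε, hε, hs⟩ : ∃ ε : ℚ, |(ε : ℝ)| = 1 ∧ ((√((e : ℝ) * p) : ℝ) : ℂ) =
      ε * ((∑ l, (w l : ℂ) * y l) * quadraticGaussSum p z) := by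
    rcases sq_eq_sq_iff_eq_or_eq_neg.1 hsq with h1 | h1
    · exact ⟨1, by simp, by simpa using h1⟩
    · exact ⟨-1, by simp, by simpa using h1⟩
  have hscale : ∑ l, ((t * ε * w l : ℚ) : ℂ) * y l = t * ε * ∑ l, (w l : ℂ) * y l := by
    rw [Finset.mul_sum]
    refine Finset.sum_congr rfl fun l _ => ?_
    push_cast
    ring
  have key := norm_mul_le_card_of_sum_eq_add_mul_quadraticGaussSum hp hM
    (fun l => t * ε * w l) y hy q hz ζ hζ (by
      rw [hscale, h, hs]
      ring)
  rw [hscale, norm_mul, norm_mul, hnorm] at key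
  have hr (x : ℚ) : ‖(x : ℂ)‖ = |(x : ℝ)| := by
    rw [← Complex.ofReal_ratCast, Complex.norm_real, Real.norm_eq_abs]
  rwa [hr, hr, hε, mul_one] at key

/-- Every complex number sharing its rational minimal polynomial with a sum of `N` roots of unity
has absolute value at most `N`. -/
theorem norm_le_card_of_aeval_minpoly_eq_zero {ι : Type*} [Fintype ι] (ζ : ι → ℂ)
    (hζ : ∀ i, ∃ k : ℕ, 0 < k ∧ ζ i ^ k = 1) {β : ℂ}
    (hβ : Polynomial.aeval β (minpoly ℚ (∑ i, ζ i)) = 0) : ‖β‖ ≤ Fintype.card ι := by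
  let K := IntermediateField.adjoin ℚ (Set.range ζ)
  have hint : ∀ x ∈ Set.range ζ, IsIntegral ℚ x := by
    rintro _ ⟨i, rfl⟩
    obtain ⟨k, hk0, hk⟩ := hζ i
    exact IsIntegral.of_pow hk0 (hk ▸ isIntegral_one)
  have : FiniteDimensional ℚ K := IntermediateField.finiteDimensional_adjoin hint
  have : NumberField K := ⟨⟩
  let ξ : ι → K := fun i => ⟨ζ i, IntermediateField.subset_adjoin ℚ _ ⟨i, rfl⟩⟩
  have hξ : algebraMap K ℂ (∑ i, ξ i) = ∑ i, ζ i := by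
    rw [map_sum]
    rfl
  have hinj : Function.Injective (algebraMap K ℂ) := (algebraMap K ℂ).injective
  rw [← hξ, minpoly.algebraMap_eq hinj] at hβ
  have hmem : β ∈ (minpoly ℚ (∑ i, ξ i)).rootSet ℂ := by
    rw [Polynomial.mem_rootSet]
    exact ⟨minpoly.ne_zero (Algebra.IsIntegral.isIntegral _), hβ⟩
  rw [← NumberField.Embeddings.range_eval_eq_rootSet_minpoly] at hmem
  obtain ⟨φ, rfl⟩ := hmem
  simp only [map_sum]
  refine (norm_sum_le _ _).trans ?_
  have h1 (i : ι) : ‖φ (ξ i)‖ = 1 := by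
    obtain ⟨k, hk0, hk⟩ := hζ i
    refine Complex.norm_eq_one_of_pow_eq_one (n := k) ?_ hk0.ne'
    have : ξ i ^ k = 1 := hinj (by rw [map_pow, map_one]; exact hk)
    rw [← map_pow, this, map_one]
  simp [h1]

open Polynomial in
/-- If `q + t √D` is a sum of `N` roots of unity and `D` is not a square, then `|t| √D ≤ N`. -/
theorem abs_mul_sqrt_le_card {ι : Type*} [Fintype ι] (ζ : ι → ℂ)
    (hζ : ∀ i, ∃ k : ℕ, 0 < k ∧ ζ i ^ k = 1) {D : ℕ} (hD : ¬ IsSquare D) (q t : ℚ)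
    (h : ∑ i, ζ i = q + t * (√(D : ℝ) : ℝ)) : |(t : ℝ)| * √D ≤ Fintype.card ι := by
  rcases eq_or_ne t 0 with rfl | ht
  · simp
  have hs : ((√(D : ℝ) : ℝ) : ℂ) ^ 2 = D := by
    rw [← Complex.ofReal_pow, Real.sq_sqrt (by positivity)]
    simp
  let f : ℚ[X] := X ^ 2 + (C (-2 * q) * X + C (q ^ 2 - t ^ 2 * D))
  have hlow : (C (-2 * q) * X + C (q ^ 2 - t ^ 2 * D) : ℚ[X]).degree < (2 : ℕ) :=
    degree_linear_le.trans_lt (by norm_num)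
  have hmonic : f.Monic := monic_X_pow_add hlow
  have hdeg : f.natDegree = 2 := by
    refine natDegree_eq_of_degree_eq_some ?_
    rw [degree_add_eq_left_of_degree_lt (by rwa [degree_X_pow]), degree_X_pow]
  have hirr : Irreducible f := by
    rw [hmonic.irreducible_iff_roots_eq_zero_of_degree_le_three (by omega) (by omega)]
    refine Multiset.eq_zero_of_forall_notMem fun x hx => hD ?_
    have hx0 : x ^ 2 + (-2 * q * x + (q ^ 2 - t ^ 2 * D)) = 0 := by
      simpa [f] using (mem_roots'.1 hx).2
    rw [← Rat.isSquare_natCast_iff]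
    refine ⟨(x - q) / t, ?_⟩
    field_simp
    linear_combination -hx0
  have hroot (s : ℂ) (hs : s ^ 2 = D) : aeval ((q : ℂ) + t * s) f = 0 := by
    simp only [f, map_add, map_mul, map_pow, aeval_X, aeval_C, eq_ratCast]
    push_cast
    linear_combination (t : ℂ) ^ 2 * hs
  have hmin : f = minpoly ℚ (∑ i, ζ i) :=
    minpoly.eq_of_irreducible_of_monic hirr (h ▸ hroot _ hs) hmonic
  have h1 := norm_le_card_of_aeval_minpoly_eq_zero ζ hζ (hmin ▸ hroot _ hs)
  have h2 := norm_le_card_of_aeval_minpoly_eq_zero ζ hζ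
    (hmin ▸ hroot (-(√(D : ℝ) : ℝ)) (by rw [neg_sq, hs]))
  have e1 : (q : ℂ) + t * (√(D : ℝ) : ℝ) = ((q + t * √D : ℝ) : ℂ) := by push_cast; rfl
  have e2 : (q : ℂ) + t * -(√(D : ℝ) : ℝ) = ((q - t * √D : ℝ) : ℂ) := by push_cast; ring
  rw [e1, Complex.norm_real, Real.norm_eq_abs] at h1
  rw [e2, Complex.norm_real, Real.norm_eq_abs] at h2
  rw [← abs_of_nonneg (Real.sqrt_nonneg (D : ℝ)), ← abs_mul, abs_le]
  rw [abs_le] at h1 h2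
  constructor <;> linarith

/-- If `c ≥ 1`, `c ≥ s − 2`, and `q + 2c√(4+s²)` is a sum of `N ≤ 8 + (3/2)s²` roots of
unity, then `s ≤ 5`. -/
theorem stmt_10 (s : ℕ) (q : ℚ) (c : ℤ) (hc1 : 1 ≤ c) (hc2 : (s : ℤ) - 2 ≤ c)
    (N : ℕ) (ζ : Fin N → ℂ)
    (hζ : ∀ i, ∃ k : ℕ, 0 < k ∧ ζ i ^ k = 1)
    (hsum : ∑ i, ζ i =
      ((q : ℝ) : ℂ) + 2 * (c : ℂ) * ((Real.sqrt (4 + (s : ℝ) ^ 2) : ℝ) : ℂ))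
    (hN : (N : ℝ) ≤ 8 + 3 / 2 * (s : ℝ) ^ 2) :
    s ≤ 5 := by
  by_contra! hs
  have hc2' : (s : ℝ) - 2 ≤ c := by exact_mod_cast hc2
  have hc0 : (0 : ℝ) ≤ c := by exact_mod_cast zero_le_one.trans hc1
  have habs : |((2 * c : ℚ) : ℝ)| = 2 * c := by
    push_cast
    exact abs_of_nonneg (by positivity)
  have hform {D : ℝ} (hD : 4 + (s : ℝ) ^ 2 = D) :
      ∑ i, ζ i = (q : ℂ) + ((2 * c : ℚ) : ℂ) * (√D : ℝ) := by
    rw [hsum, hD]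
    push_cast
    rfl
  rcases lt_or_ge s 10 with hs10 | hs10
  · have : Fact (Nat.Prime 5) := ⟨by norm_num⟩
    have : Fact (Nat.Prime 17) := ⟨by norm_num⟩
    have : Fact (Nat.Prime 53) := ⟨by norm_num⟩
    interval_cases s
    · have hy := Complex.isPrimitiveRoot_exp 8 (by norm_num)
      set y := Complex.exp (2 * Real.pi * Complex.I / (8 : ℕ))
      have hy4 : y ^ 4 = -1 := by
        have h4 : (y ^ 4 - 1) * (y ^ 4 + 1) = 0 := by linear_combination hy.pow_eq_one
        rcases mul_eq_zero.1 h4 with h | h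
        · exact absurd (sub_eq_zero.1 h) (hy.pow_ne_one_of_pos_of_lt (by norm_num) (by norm_num))
        · exact eq_neg_of_add_eq_zero_left h
      have key := abs_mul_sqrt_mul_le_card (p := 5) (M := 8) (e := 8) (by norm_num) (by norm_num)
        (fun _ : Fin 2 => 2) ![y, y ^ 7]
        (by
          intro l
          fin_cases l
          · exact hy.pow_eq_one
          · change (y ^ 7) ^ 8 = 1
            rw [← pow_mul, mul_comm, pow_mul, hy.pow_eq_one, one_pow])
        (by
          simp only [Fin.sum_univ_two, Matrix.cons_val_zero, Matrix.cons_val_one]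
          push_cast
          linear_combination (4 * y ^ 2 + 4 * y ^ 10 - 4 * y ^ 6 + 8 * y ^ 4 - 8) * hy4)
        q (2 * c) ζ hζ (hform (by norm_num))
      rw [habs, Fintype.card_fin] at key
      have h2 : (2 : ℝ) ≤ √(8 : ℕ) := Real.le_sqrt_of_sq_le (by norm_num)
      push_cast at hN hc2' key h2
      nlinarith
    · have key := abs_mul_sqrt_mul_le_card (p := 53) (M := 1) (e := 1) (by norm_num) (by norm_num)
        (fun _ : Unit => 1) (fun _ => 1) (by simp) (by simp) q (2 * c) ζ hζ (hform (by norm_num))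
      rw [habs, Fintype.card_fin] at key
      norm_num at hc2' key hN ⊢
      linarith
    · have key := abs_mul_sqrt_mul_le_card (p := 17) (M := 1) (e := 4) (by norm_num) (by norm_num)
        (fun _ : Unit => 2) (fun _ => 1) (by simp) (by norm_num) q (2 * c) ζ hζ
        (hform (by norm_num))
      rw [habs, Fintype.card_fin] at key
      have h2 : (2 : ℝ) ≤ √(4 : ℕ) := Real.le_sqrt_of_sq_le (by norm_num)
      push_cast at hN hc2' key h2
      nlinarith
    · have hz := Complex.isPrimitiveRoot_exp 5 (by norm_num)
      have key := abs_mul_sqrt_mul_le_card (p := 17) (M := 5) (e := 5) (by norm_num) (by norm_num)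
        (fun j : ZMod 5 => (quadraticChar (ZMod 5) j : ℚ)) (fun j => _ ^ j.val)
        (fun j => by rw [← pow_mul, mul_comm, pow_mul, hz.pow_eq_one, one_pow])
        (by simpa [quadraticGaussSum] using quadraticGaussSum_sq (by norm_num) hz)
        q (2 * c) ζ hζ (hform (by norm_num))
      rw [habs, Fintype.card_fin] at key
      have h2 : (2 : ℝ) ≤ √(5 : ℕ) := Real.le_sqrt_of_sq_le (by norm_num)
      push_cast at hN hc2' key h2
      nlinarith
  · have hD : ¬ IsSquare (4 + s ^ 2) := by
      rintro ⟨r, hr⟩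
      have h1 : s < r := by nlinarith
      nlinarith
    have key := abs_mul_sqrt_le_card ζ hζ hD q (2 * c) (hform (by push_cast; rfl))
    rw [habs, Fintype.card_fin] at key
    have hs10' : (10 : ℝ) ≤ s := by exact_mod_cast hs10
    have hsqrt : (s : ℝ) ≤ √((4 + s ^ 2 : ℕ) : ℝ) :=
      Real.le_sqrt_of_sq_le (by push_cast; linarith)
    have h3 : ((s : ℝ) - 2) * s ≤ c * √((4 + s ^ 2 : ℕ) : ℝ) :=
      mul_le_mul hc2' hsqrt (by positivity) hc0
    nlinarith
end
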